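/- Let n ≥ 3, let q > 0 and let p ∈ ℝ satisfy p + q ≤ (n+2)/(n−2). Then every positive classical solution u of Δu + |∇u|^q u^p = 0 on all of ℝ^n is constant. -/

import Mathlib

open scoped BigOperators

/-- The Euclidean Laplacian of `u : ℝⁿ → ℝ`, defined as the sum of the second
partial derivatives in the coordinate directions. -/
noncomputable def elaplacian {n : ℕ} (u : EuclideanSpace ℝ (Fin n) → ℝ)
    (x : EuclideanSpace ℝ (Fin n)) : ℝ :=
  ∑ i : Fin n, fderiv ℝ (fun y => fderiv ℝ u y (EuclideanSpace.single i 1)) x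
    (EuclideanSpace.single i 1)

section

open Filter Topology Set

/-- A slowly varying plateau function. -/
lemma exists_slow_cutoff (T ε : ℝ) (hε : 0 < ε) :
    ∃ χ : ℝ → ℝ, ContDiff ℝ 1 χ ∧ HasCompactSupport χ ∧ (∀ t, 0 ≤ χ t ∧ χ t ≤ 1) ∧
      (∀ t, |deriv χ t| ≤ ε) ∧
      ∀ t, |t| < T → χ t = 1 ∧ deriv χ t = 0 := by
  set S := Real.smoothTransition with hS
  have hScd : ContDiff ℝ 1 S := Real.smoothTransition.contDiff
  have hSd : Differentiable ℝ S := hScd.differentiable (by norm_num)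
  obtain ⟨L, hL0, hL⟩ : ∃ L : ℝ, 0 < L ∧ ∀ t, |deriv S t| ≤ L := by
    have hc : Continuous (deriv S) := hScd.continuous_deriv le_rfl
    have hcs : HasCompactSupport (deriv S) := by
      refine HasCompactSupport.intro (isCompact_Icc (a := (0 : ℝ)) (b := 1)) ?_
      intro x hx
      have hx' : x < 0 ∨ 1 < x := by
        by_contra h
        push Not at h
        exact hx ⟨h.1, h.2⟩
      rcases hx' with h | h
      · have : S =ᶠ[𝓝 x] fun _ => (0 : ℝ) := by
          filter_upwards [Iio_mem_nhds h] with y hy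
          exact Real.smoothTransition.zero_of_nonpos (le_of_lt hy)
        rw [this.deriv_eq]; simp
      · have : S =ᶠ[𝓝 x] fun _ => (1 : ℝ) := by
          filter_upwards [Ioi_mem_nhds h] with y hy
          exact Real.smoothTransition.one_of_one_le (le_of_lt hy)
        rw [this.deriv_eq]; simp
    obtain ⟨C, hC⟩ := hc.bounded_above_of_compact_support hcs
    exact ⟨|C| + 1, by positivity, fun t => (hC t).trans (by linarith [le_abs_self C])⟩
  have hlog : 0 ≤ Real.log (1 + T ^ 2) := Real.log_nonneg (by nlinarith [sq_nonneg T])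
  obtain ⟨d, hd0, hdL, hdT⟩ : ∃ d : ℝ, 0 < d ∧ L * d ≤ ε ∧ d * Real.log (1 + T ^ 2) ≤ 1 := by
    refine ⟨min (ε / L) (1 / (Real.log (1 + T ^ 2) + 1)), by positivity, ?_, ?_⟩
    · calc _ ≤ L * (ε / L) := by gcongr; exact min_le_left _ _
        _ = ε := by field_simp
    · calc _ ≤ 1 / (Real.log (1 + T ^ 2) + 1) * Real.log (1 + T ^ 2) := by
            gcongr; exact min_le_right _ _
        _ ≤ 1 := by rw [one_div, inv_mul_le_iff₀ (by positivity)]; linarith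
  have hpos : ∀ t : ℝ, 0 < 1 + t ^ 2 := fun t => by positivity
  have hder : ∀ t, HasDerivAt (fun t => S (2 - d * Real.log (1 + t ^ 2)))
      (deriv S (2 - d * Real.log (1 + t ^ 2)) * (-(d * (2 * t / (1 + t ^ 2))))) t := by
    intro t
    have h1 : HasDerivAt (fun t : ℝ => 1 + t ^ 2) (2 * t) t := by
      simpa using (hasDerivAt_pow 2 t).const_add 1
    have h2 := ((h1.log (hpos t).ne').const_mul d).const_sub 2
    exact (hSd _).hasDerivAt.comp t h2
  refine ⟨fun t => S (2 - d * Real.log (1 + t ^ 2)), ?_, ?_, ?_, ?_, ?_⟩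
  · refine hScd.comp (contDiff_const.sub (contDiff_const.mul (ContDiff.log ?_ ?_)))
    · fun_prop
    · exact fun t => (hpos t).ne'
  · refine HasCompactSupport.intro (isCompact_Icc (a := -Real.exp (2 / d)) (b := Real.exp (2 / d))) ?_
    intro t ht
    apply Real.smoothTransition.zero_of_nonpos
    have ht' : Real.exp (2 / d) < |t| := by
      by_contra h
      exact ht (abs_le.1 (not_lt.1 h))
    have h1 : 1 < Real.exp (2 / d) := Real.one_lt_exp_iff.2 (by positivity)
    have h2 : Real.exp (2 / d) ≤ 1 + t ^ 2 := by
      have : |t| ≤ t ^ 2 := by rw [← sq_abs]; nlinarith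
      linarith
    have h3 : 2 / d ≤ Real.log (1 + t ^ 2) := (Real.le_log_iff_exp_le (hpos t)).2 h2
    rw [div_le_iff₀ hd0] at h3
    linarith
  · exact fun t => ⟨Real.smoothTransition.nonneg _, Real.smoothTransition.le_one _⟩
  · intro t
    rw [(hder t).deriv, abs_mul, abs_neg, abs_mul, abs_of_pos hd0]
    have : |2 * t / (1 + t ^ 2)| ≤ 1 := by
      rw [abs_div, abs_of_pos (hpos t), div_le_one (hpos t), abs_le]
      constructor <;> nlinarith [sq_nonneg (t - 1), sq_nonneg (t + 1)]
    calc _ ≤ L * (d * 1) := by gcongr; exact hL _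
      _ ≤ ε := by simpa using hdL
  · intro t ht
    have hone : ∀ t, |t| < T → S (2 - d * Real.log (1 + t ^ 2)) = 1 := by
      intro t ht
      apply Real.smoothTransition.one_of_one_le
      have : t ^ 2 ≤ T ^ 2 := by
        rw [← sq_abs t]; exact pow_le_pow_left₀ (abs_nonneg t) ht.le 2
      have : Real.log (1 + t ^ 2) ≤ Real.log (1 + T ^ 2) :=
        Real.log_le_log (hpos t) (by linarith)
      nlinarith
    refine ⟨hone t ht, ?_⟩
    have : (fun t => S (2 - d * Real.log (1 + t ^ 2))) =ᶠ[𝓝 t] fun _ => (1 : ℝ) := by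
      filter_upwards [(isOpen_lt continuous_abs continuous_const).mem_nhds ht] with y hy
      exact hone y hy
    rw [this.deriv_eq]; simp

/-- The coefficient of `|∇h|²` produced by the Bochner formula for the auxiliary function
`log |∇h|² + ω`, where `θ = ω'` and `θ' = ω''`. -/
noncomputable def bochnerMain (m q s Z θ θ' : ℝ) : ℝ :=
  θ' * (s / (1 + (q / 2 - 1) * θ)) ^ 2 + (1 + (q / 2 - 1) * θ) *
    (-(s * θ / (1 + (q / 2 - 1) * θ)) ^ 2 / 2
      + 2 * (1 + Z - s * θ / (1 + (q / 2 - 1) * θ) / 2) ^ 2 / m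
      + (2 + q * Z) * (s * θ / (1 + (q / 2 - 1) * θ)) - 2 * s * Z
      - s * θ / (1 + (q / 2 - 1) * θ) * (1 + Z))

/-- A function `ω` of one variable for which the Bernstein argument closes. -/
structure BernsteinProfile (m q s : ℝ) where
  ω : ℝ → ℝ
  θ : ℝ → ℝ
  θ' : ℝ → ℝ
  c : ℝ
  M : ℝ
  c_pos : 0 < c
  hasDerivAt_ω : ∀ t, HasDerivAt ω (θ t) t
  hasDerivAt_θ : ∀ t, HasDerivAt θ (θ' t) t
  continuous_θ' : Continuous θ'
  ω_le : ∀ t, ω t ≤ M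
  abs_θ_le : ∀ t, |θ t| ≤ M
  abs_θ'_le : ∀ t, |θ' t| ≤ M
  le_slope : ∀ t, c ≤ 1 + (q / 2 - 1) * θ t
  le_main : ∀ t, c * (1 + Real.exp t) ^ 2 ≤ bochnerMain m q s (Real.exp t) (θ t) (θ' t)

lemma exists_pos_forall_le {f : ℝ → ℝ} (hf : Continuous f) (hpos : ∀ t, 0 < f t) {c : ℝ}
    (hc : 0 < c) (h : ∀ᶠ t in cocompact ℝ, c ≤ f t) : ∃ c' > 0, ∀ t, c' ≤ f t := by
  obtain ⟨K, hK, hKc⟩ := mem_cocompact.1 h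
  rcases K.eq_empty_or_nonempty with rfl | hne
  · exact ⟨c, hc, fun t => hKc (by simp)⟩
  · obtain ⟨x, -, hx⟩ := hK.exists_isMinOn hne hf.continuousOn
    refine ⟨min c (f x), lt_min hc (hpos x), fun t => ?_⟩
    by_cases ht : t ∈ K
    · exact (min_le_right _ _).trans (hx ht)
    · exact (min_le_left _ _).trans (hKc ht)

lemma bochnerMain_zero (m q s Z : ℝ) : bochnerMain m q s Z 0 0 = 2 * (1 + Z) ^ 2 / m - 2 * s * Z := by
  simp [bochnerMain]

lemma nonempty_profile_of_slope {m q s : ℝ} (hm : 2 ≤ m) {θ : ℝ → ℝ}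
    (hθ : ContDiff ℝ 1 θ) (hcs : HasCompactSupport θ)
    (hμ : ∀ t, 0 < 1 + (q / 2 - 1) * θ t)
    (hE : ∀ t, 0 < bochnerMain m q s (Real.exp t) (θ t) (deriv θ t)) :
    Nonempty (BernsteinProfile m q s) := by
  have hd : Differentiable ℝ θ := hθ.differentiable (by norm_num)
  have hdc : Continuous (deriv θ) := hθ.continuous_deriv le_rfl
  have hcs' : HasCompactSupport (deriv θ) := hcs.deriv
  obtain ⟨M₁, hM₁⟩ := hθ.continuous.bounded_above_of_compact_support hcs
  obtain ⟨M₂, hM₂⟩ := hdc.bounded_above_of_compact_support hcs'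
  have hev : ∀ᶠ t in cocompact ℝ, θ t = 0 := by
    filter_upwards [hcs.isCompact.compl_mem_cocompact] with t ht
    exact image_eq_zero_of_notMem_tsupport ht
  have hev' : ∀ᶠ t in cocompact ℝ, deriv θ t = 0 := by
    filter_upwards [hcs'.isCompact.compl_mem_cocompact] with t ht
    exact image_eq_zero_of_notMem_tsupport ht
  obtain ⟨c₁, hc₁, hc₁'⟩ := exists_pos_forall_le (f := fun t => 1 + (q / 2 - 1) * θ t)
    (continuous_const.add (continuous_const.mul hθ.continuous)) hμ one_pos
    (by filter_upwards [hev] with t ht; simp [ht])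
  have hY : ∀ t, 0 < (1 + Real.exp t) ^ 2 := fun t => by positivity
  have hsmall : ∀ᶠ t in cocompact ℝ, 2 * s * m * Real.exp t ≤ (1 + Real.exp t) ^ 2 := by
    have h1 : ∀ᶠ t in (atBot : Filter ℝ), 2 * s * m * Real.exp t ≤ (1 + Real.exp t) ^ 2 := by
      have : Tendsto (fun t => 2 * s * m * Real.exp t) atBot (𝓝 (2 * s * m * 0)) :=
        Real.tendsto_exp_atBot.const_mul _
      rw [mul_zero] at this
      filter_upwards [this.eventually (gt_mem_nhds one_pos)] with t ht
      nlinarith [Real.exp_pos t]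
    have h2 : ∀ᶠ t in (atTop : Filter ℝ), 2 * s * m * Real.exp t ≤ (1 + Real.exp t) ^ 2 := by
      filter_upwards [Real.tendsto_exp_atTop.eventually (eventually_ge_atTop (2 * s * m))] with t ht
      nlinarith [Real.exp_pos t]
    rw [cocompact_eq_atBot_atTop]
    exact eventually_sup.2 ⟨h1, h2⟩
  obtain ⟨c₂, hc₂, hc₂'⟩ := exists_pos_forall_le
    (f := fun t => bochnerMain m q s (Real.exp t) (θ t) (deriv θ t) / (1 + Real.exp t) ^ 2)
    (by
      refine Continuous.div ?_ (by fun_prop) fun t => (hY t).ne'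
      have := hθ.continuous
      unfold bochnerMain
      have hne : ∀ t, 1 + (q / 2 - 1) * θ t ≠ 0 := fun t => (hμ t).ne'
      fun_prop (disch := assumption))
    (fun t => div_pos (hE t) (hY t)) (c := 1 / m) (by positivity)
    (by
      filter_upwards [hev, hev', hsmall] with t h1 h2 h3
      rw [h1, h2, bochnerMain_zero, le_div_iff₀ (hY t), div_mul_eq_mul_div, div_le_iff₀ (by linarith),
        sub_mul, div_mul_cancel₀ _ (by linarith)]
      linarith)
  refine ⟨⟨fun t => ∫ x in (0 : ℝ)..t, θ x, θ, deriv θ, min c₁ c₂,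
    max (max M₁ M₂) (∫ x, ‖θ x‖), lt_min hc₁ hc₂, ?_, fun t => (hd t).hasDerivAt, hdc, ?_, ?_, ?_, ?_,
    ?_⟩⟩
  · exact fun t => intervalIntegral.integral_hasDerivAt_right
      (hθ.continuous.intervalIntegrable _ _)
      (hθ.continuous.stronglyMeasurableAtFilter _ _) hθ.continuous.continuousAt
  · intro t
    refine le_trans (le_trans (Real.le_norm_self _)
      intervalIntegral.norm_integral_le_integral_norm_uIoc) (le_trans ?_ (le_max_right _ _))
    exact MeasureTheory.setIntegral_le_integral
      (hθ.continuous.integrable_of_hasCompactSupport hcs).norm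
      (Eventually.of_forall fun _ => norm_nonneg _)
  · exact fun t => (hM₁ t).trans (by simp)
  · exact fun t => (hM₂ t).trans (by simp)
  · exact fun t => (min_le_left _ _).trans (hc₁' t)
  · intro t
    have := hc₂' t
    rw [le_div_iff₀ (hY t)] at this
    exact le_trans (by gcongr; exact min_le_right _ _) this

lemma bochnerMain_eq {m q s Z κ κ' : ℝ} (hm : m ≠ 0) (hs : s ≠ 0)
    (hσ : s + (1 - q / 2) * κ ≠ 0) :
    bochnerMain m q s Z (κ / (s + (1 - q / 2) * κ)) (s * κ' / (s + (1 - q / 2) * κ) ^ 2)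
      = s / (s + (1 - q / 2) * κ) * ((s + (1 - q / 2) * κ) * (κ' - 2 * Z)
        + (2 * (1 + Z) - κ) * (2 * (1 + Z) + (m - 1) * κ) / (2 * m)) := by
  generalize hσ' : s + (1 - q / 2) * κ = σ at hσ ⊢
  have hμ : 1 + (q / 2 - 1) * (κ / σ) = s / σ := by
    field_simp
    linarith
  rw [bochnerMain, hμ]
  have : s * (κ / σ) / (s / σ) = κ := by field_simp
  rw [this]
  have h2 : s / (s / σ) = σ := by field_simp
  rw [h2]
  subst hσ'
  field_simp
  ring

lemma two_add_mul_pos {d x : ℝ} (hd : 0 < 2 + d) (hx : x ∈ Icc (0 : ℝ) 1) : 0 < 2 + d * x := by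
  rcases le_total 0 d with h | h
  · linarith [mul_nonneg h hx.1]
  · nlinarith [mul_nonneg_of_nonpos_of_nonpos h (sub_nonpos.2 hx.2)]

lemma exists_affine_slope {m q s : ℝ} (hm : 2 ≤ m) (hq : 0 < q) (hq2 : q ≤ 2) (hs : 4 / m ≤ s)
    (hs' : s ≤ 4 / (m - 1)) :
    ∃ a b : ℝ, a ≤ 0 ∧ 0 < b ∧ b < 2 ∧ 0 < s + (1 - q / 2) * a ∧ 0 < 2 + (m - 1) * a ∧
      0 < 2 - (m + 1 - q * m) * b ∧
      ∀ Z, 0 ≤ Z → 0 < (s + (1 - q / 2) * (a + b * Z)) * (b * Z - 2 * Z)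
        + (2 * (1 + Z) - (a + b * Z)) * (2 * (1 + Z) + (m - 1) * (a + b * Z)) / (2 * m) := by
  have hm1 : 0 < m - 1 := by linarith
  have hm0 : 0 < m := by linarith
  have hd : 0 < m + 1 + q := by linarith
  set b : ℝ := 2 * (1 + q) / (m + 1 + q) with hb
  have h2b : 2 - b = 2 * m / (m + 1 + q) := by rw [hb]; field_simp; ring
  have hb0 : 0 < b := by positivity
  have hb2 : b < 2 := by
    have : 0 < 2 * m / (m + 1 + q) := by positivity
    linarith
  set B₁ : ℝ := (1 - q / 2) * b - 2 / m - (m - 1) * b / m + q - 1 with hB₁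
  set C : ℝ := 2 * m * q ^ 2 / (m + 1 + q) ^ 2 with hC
  have hC0 : 0 < C := by positivity
  obtain ⟨α, hα, hα1, hα2⟩ : ∃ α : ℝ, 0 < α ∧ α ≤ 1 / (m - 1) ∧
      α * (B₁ ^ 2 + 1) * m ≤ C * (m - 1) := by
    refine ⟨min (1 / (m - 1)) (C * (m - 1) / ((B₁ ^ 2 + 1) * m)), by positivity,
      min_le_left _ _, ?_⟩
    rw [mul_assoc, ← le_div_iff₀ (by positivity)]
    exact min_le_right _ _
  have hαm : α * (m - 1) ≤ 1 := by rwa [le_div_iff₀ hm1] at hα1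
  refine ⟨-2 / (m - 1) + α, b, ?_, hb0, hb2, ?_, ?_, ?_, ?_⟩
  · have : -2 / (m - 1) + α = (-2 + α * (m - 1)) / (m - 1) := by field_simp
    rw [this]
    exact div_nonpos_of_nonpos_of_nonneg (by linarith) hm1.le
  · have h1 : 0 ≤ (1 - q / 2) * α := mul_nonneg (by linarith) hα.le
    have h2 : (1 - q / 2) * (-2 / (m - 1)) = -2 / (m - 1) + q / (m - 1) := by field_simp; ring
    have h3 : 0 < q / (m - 1) := by positivity
    have h4 : 2 / (m - 1) ≤ 4 / m := by rw [div_le_div_iff₀ hm1 hm0]; linarith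
    have h5 : -2 / (m - 1) = -(2 / (m - 1)) := by ring
    rw [mul_add, h2, h5]
    linarith
  · have : 2 + (m - 1) * (-2 / (m - 1) + α) = (m - 1) * α := by field_simp; ring
    rw [this]; positivity
  · have : 2 - (m + 1 - q * m) * b = 2 * q ^ 2 * m / (m + 1 + q) := by
      rw [hb]; field_simp; ring
    rw [this]; positivity
  · intro Z hZ
    have key : (s + (1 - q / 2) * (-2 / (m - 1) + α + b * Z)) * (b * Z - 2 * Z)
        + (2 * (1 + Z) - (-2 / (m - 1) + α + b * Z))
          * (2 * (1 + Z) + (m - 1) * (-2 / (m - 1) + α + b * Z)) / (2 * m)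
        = (2 * m - (m - 1) * α) * α / (2 * m)
          + ((2 - b) * (4 / (m - 1) - s) + α * B₁) * Z + C * Z ^ 2 := by
      rw [hB₁, hC, hb]; field_simp; ring
    rw [key]
    have h0 : 0 ≤ (2 - b) * (4 / (m - 1) - s) * Z :=
      mul_nonneg (mul_nonneg (by linarith) (by linarith)) hZ
    have h1 : (m - 1) * α / m ≤ (2 * m - (m - 1) * α) * α / (2 * m) := by
      rw [div_le_div_iff₀ hm0 (by positivity)]
      nlinarith [mul_pos hα hm0]
    have h2 : 0 < (m - 1) * α / m + α * B₁ * Z + C * Z ^ 2 := by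
      have h3 : α * (B₁ ^ 2 + 1) / ((m - 1) / m) ≤ C := by
        rw [div_div_eq_mul_div, div_le_iff₀ hm1]; exact hα2
      set k := (m - 1) / m with hk
      have hk0 : 0 < k := by positivity
      have h4 : α * (B₁ ^ 2 + 1) ≤ C * k := by rwa [div_le_iff₀ hk0] at h3
      have h5 : (m - 1) * α / m = k * α := by rw [hk]; ring
      rw [h5]
      have h6 : 0 < k * (k * α + α * B₁ * Z + C * Z ^ 2) := by
        have h7 := mul_le_mul_of_nonneg_right h4 (sq_nonneg Z)
        have h8 : 0 < α * ((k / 2 + B₁ * Z) ^ 2 + 3 / 4 * k ^ 2 + Z ^ 2) := by positivity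
        linarith
      exact pos_of_mul_pos_right h6 hk0.le
    linarith

lemma nonempty_profile_of_q_le_two {m q s : ℝ} (hm : 2 ≤ m) (hq : 0 < q) (hq2 : q ≤ 2)
    (hs : 4 / m ≤ s) (hs' : s ≤ 4 / (m - 1)) : Nonempty (BernsteinProfile m q s) := by
  obtain ⟨a, b, ha, hb0, hb2, hσ, hA, hC, hE⟩ := exists_affine_slope hm hq hq2 hs hs'
  have hm0 : 0 < m := by linarith
  have hm1 : 0 < m - 1 := by linarith
  have hs0 : 0 < s := lt_of_lt_of_le (by positivity) hs
  have hρ : 0 ≤ 1 - q / 2 := by linarith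
  have hleft : ∀ᶠ z : ℝ × ℝ in 𝓝 (0, 0), ∀ x ∈ Icc (0 : ℝ) 1,
      0 < (s + (1 - q / 2) * (x * (a + b * z.1)))
          * (z.2 * (a + b * z.1) + x * (b * z.1) - 2 * z.1)
        + (2 * (1 + z.1) - x * (a + b * z.1)) * (2 * (1 + z.1) + (m - 1) * (x * (a + b * z.1)))
          / (2 * m) := by
    refine isCompact_Icc.eventually_forall_of_forall_eventually fun x hx => ?_
    refine continuousAt_const.eventually_lt (g := fun y : (ℝ × ℝ) × ℝ =>
      (s + (1 - q / 2) * (y.2 * (a + b * y.1.1)))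
          * (y.1.2 * (a + b * y.1.1) + y.2 * (b * y.1.1) - 2 * y.1.1)
        + (2 * (1 + y.1.1) - y.2 * (a + b * y.1.1))
          * (2 * (1 + y.1.1) + (m - 1) * (y.2 * (a + b * y.1.1))) / (2 * m)) (by fun_prop) ?_
    simp only [mul_zero, add_zero, sub_zero, zero_mul, zero_add, mul_one]
    have h1 : 0 < 2 - x * a := by nlinarith [hx.1]
    have h2 : 0 < 2 + (m - 1) * (x * a) := by
      linarith [two_add_mul_pos hA hx]
    positivity
  have hright : ∀ᶠ z : ℝ × ℝ in 𝓝 (0, 0), ∀ x ∈ Icc (0 : ℝ) 1,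
      0 < (s * z.1 + (1 - q / 2) * (x * (a * z.1 + b)))
          * (z.2 * (a * z.1 + b) + x * b - 2)
        + (2 * (z.1 + 1) - x * (a * z.1 + b)) * (2 * (z.1 + 1) + (m - 1) * (x * (a * z.1 + b)))
          / (2 * m) := by
    refine isCompact_Icc.eventually_forall_of_forall_eventually fun x hx => ?_
    refine continuousAt_const.eventually_lt (g := fun y : (ℝ × ℝ) × ℝ =>
      (s * y.1.1 + (1 - q / 2) * (y.2 * (a * y.1.1 + b)))
          * (y.1.2 * (a * y.1.1 + b) + y.2 * b - 2)
        + (2 * (y.1.1 + 1) - y.2 * (a * y.1.1 + b))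
          * (2 * (y.1.1 + 1) + (m - 1) * (y.2 * (a * y.1.1 + b))) / (2 * m)) (by fun_prop) ?_
    simp only [mul_zero, zero_add, zero_mul, mul_one]
    have h1 : 0 < 2 - x * b := by nlinarith [hx.1, hx.2]
    have h2 : 0 < 2 - (m + 1 - q * m) * (x * b) := by
      linarith [two_add_mul_pos (d := -((m + 1 - q * m) * b)) (by linarith) hx]
    have h3 : (1 - q / 2) * (x * b) * (x * b - 2) + (2 - x * b) * (2 + (m - 1) * (x * b)) / (2 * m)
      = (2 - x * b) * (2 - (m + 1 - q * m) * (x * b)) / (2 * m) := by field_simp; ring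
    rw [h3]
    positivity
  obtain ⟨δ, hδ, hball⟩ := Metric.eventually_nhds_iff.1 (hleft.and hright)
  obtain ⟨χ, hχ, hχs, hχ01, hχd, hχ1⟩ := exists_slow_cutoff (|Real.log δ| + 1) (δ / 2) (by positivity)
  have hχdiff : Differentiable ℝ χ := hχ.differentiable (by norm_num)
  have hσpos : ∀ t, 0 < s + (1 - q / 2) * (χ t * (a + b * Real.exp t)) := by
    intro t
    have h1 := mul_nonneg (mul_nonneg hρ (hχ01 t).1) (mul_nonneg hb0.le (Real.exp_pos t).le)
    have h2 : (1 - q / 2) * a ≤ (1 - q / 2) * (χ t * a) :=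
      mul_le_mul_of_nonneg_left (by nlinarith [hχ01 t]) hρ
    nlinarith
  have hder : ∀ t, HasDerivAt (fun t => χ t * (a + b * Real.exp t))
      (deriv χ t * (a + b * Real.exp t) + χ t * (b * Real.exp t)) t := fun t =>
    (hχdiff t).hasDerivAt.mul (((Real.hasDerivAt_exp t).const_mul b).const_add a)
  have hθd : ∀ t, HasDerivAt
      (fun t => χ t * (a + b * Real.exp t) / (s + (1 - q / 2) * (χ t * (a + b * Real.exp t))))
      (s * (deriv χ t * (a + b * Real.exp t) + χ t * (b * Real.exp t))
        / (s + (1 - q / 2) * (χ t * (a + b * Real.exp t))) ^ 2) t := by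
    intro t
    refine ((hder t).div (((hder t).const_mul (1 - q / 2)).const_add s) (hσpos t).ne').congr_deriv ?_
    congr 1; ring
  refine nonempty_profile_of_slope hm (θ := fun t => χ t * (a + b * Real.exp t) /
    (s + (1 - q / 2) * (χ t * (a + b * Real.exp t)))) ?_ ?_ ?_ ?_
  · have : ContDiff ℝ 1 fun t => χ t * (a + b * Real.exp t) := by fun_prop
    exact this.div (contDiff_const.add (contDiff_const.mul this)) fun t => (hσpos t).ne'
  · refine hχs.mono fun t ht => ?_
    contrapose! ht
    simp only [Function.mem_support, not_not] at ht
    simp [ht]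
  · intro t
    have h := hσpos t
    have : 1 + (q / 2 - 1) * (χ t * (a + b * Real.exp t) /
        (s + (1 - q / 2) * (χ t * (a + b * Real.exp t))))
        = s / (s + (1 - q / 2) * (χ t * (a + b * Real.exp t))) := by
      generalize χ t * (a + b * Real.exp t) = κ at h ⊢
      generalize hσ' : s + (1 - q / 2) * κ = σ at h ⊢
      field_simp
      linarith
    rw [this]; positivity
  · intro t
    rw [(hθd t).deriv, bochnerMain_eq hm0.ne' hs0.ne' (hσpos t).ne']
    refine mul_pos (div_pos hs0 (hσpos t)) ?_
    have hZ := Real.exp_pos t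
    by_cases ht : |t| < |Real.log δ| + 1
    · obtain ⟨h1, h2⟩ := hχ1 t ht
      rw [h1, h2]
      simpa using hE _ hZ.le
    · have hχd' : |deriv χ t| < δ := (hχd t).trans_lt (by linarith)
      rw [not_lt] at ht
      rcases le_total 0 t with h | h
      · have hx : Real.exp (-t) < δ := by
          rw [← Real.lt_log_iff_exp_lt hδ]
          rw [abs_of_nonneg h] at ht
          linarith [neg_abs_le (Real.log δ)]
        have := (@hball (Real.exp (-t), deriv χ t) (by
          rw [Prod.dist_eq]
          simp [hx, hχd'])).2 (χ t) (hχ01 t)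
        have h3 := mul_pos this (mul_pos hZ hZ)
        simp only at h3
        have h4 : Real.exp (-t) * Real.exp t = 1 := by rw [← Real.exp_add]; simp
        generalize Real.exp (-t) = x at h3 h4
        generalize Real.exp t = Z at *
        have h5 : ((s * x + (1 - q / 2) * (χ t * (a * x + b))) * (deriv χ t * (a * x + b) + χ t * b - 2)
          + (2 * (x + 1) - χ t * (a * x + b)) * (2 * (x + 1) + (m - 1) * (χ t * (a * x + b))) / (2 * m))
          * (Z * Z) = (s * (x * Z) + (1 - q / 2) * (χ t * (a * (x * Z) + b * Z)))
            * (deriv χ t * (a * (x * Z) + b * Z) + χ t * (b * Z) - 2 * Z)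
          + (2 * (x * Z + Z) - χ t * (a * (x * Z) + b * Z))
            * (2 * (x * Z + Z) + (m - 1) * (χ t * (a * (x * Z) + b * Z))) / (2 * m) := by ring
        rw [h5, h4] at h3
        simpa using h3
      · have hx : Real.exp t < δ := by
          rw [← Real.lt_log_iff_exp_lt hδ]
          rw [abs_of_nonpos h] at ht
          linarith [neg_abs_le (Real.log δ)]
        simpa using (@hball (Real.exp t, deriv χ t) (by
          rw [Prod.dist_eq]
          simp [hx, hχd'])).1 (χ t) (hχ01 t)

lemma cutoff_main_pos_of_small {m s g Z χ χ' P : ℝ} (hm : 2 ≤ m) (hs : 0 < s) (hg : 0 < g)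
    (hZ : 0 < Z) (hχ : χ ∈ Icc (0 : ℝ) 1) (hχ' : |χ'| ≤ 1) (hP : P = 1 + g * Z * χ)
    (h : 2 * s * m * Z < 1) :
    0 < s * (2 * Z * (χ + χ') - 2 * Z * P ^ 2)
      + P / (2 * m) * ((2 * (1 + Z) * P - 2 * Z * χ) * (2 * (1 + Z) * P + (m - 1) * (2 * Z * χ))) := by
  obtain ⟨h0, h1⟩ := hχ
  have hP1 : 1 ≤ P := by rw [hP]; have := mul_nonneg (mul_pos hg hZ).le h0; linarith
  have hm0 : 0 < m := by linarith
  have e1 : 2 * P ≤ 2 * (1 + Z) * P - 2 * Z * χ := by nlinarith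
  have e2 : 2 * P ≤ 2 * (1 + Z) * P + (m - 1) * (2 * Z * χ) := by
    have : 0 ≤ (m - 1) * (2 * Z * χ) := by
      have : 0 ≤ m - 1 := by linarith
      positivity
    nlinarith
  have e3 : P / (2 * m) * (2 * P * (2 * P)) ≤ P / (2 * m) *
      ((2 * (1 + Z) * P - 2 * Z * χ) * (2 * (1 + Z) * P + (m - 1) * (2 * Z * χ))) := by
    gcongr
    exact le_trans (by positivity) e1
  have e4 : -(s * (4 * Z * P ^ 2)) ≤ s * (2 * Z * (χ + χ') - 2 * Z * P ^ 2) := by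
    rw [← mul_neg]
    gcongr
    have := neg_le_of_abs_le hχ'
    have hP2 : 1 ≤ P ^ 2 := one_le_pow₀ hP1
    have := mul_nonneg (mul_pos two_pos hZ).le (by linarith : 0 ≤ χ + χ' + P ^ 2)
    linarith
  have e5 : s * (4 * Z * P ^ 2) < P / (2 * m) * (2 * P * (2 * P)) := by
    have : P / (2 * m) * (2 * P * (2 * P)) = 2 * P ^ 2 / m * P := by field_simp
    rw [this]
    calc s * (4 * Z * P ^ 2) = 2 * P ^ 2 / m * (2 * s * m * Z) := by field_simp; ring
      _ < 2 * P ^ 2 / m * P := by gcongr; linarith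
  linarith

lemma cutoff_main_pos_of_large {m s g Z χ χ' P : ℝ} (hm : 2 ≤ m) (hs : 0 < s) (hg : 0 < g)
    (hZ : 0 < Z) (hχ : χ ∈ Icc (0 : ℝ) 1) (hχ' : |χ'| ≤ 1) (hP : P = 1 + g * Z * χ)
    (h : 4 * s * m < Z) (hgZ : 1 ≤ g * Z) :
    0 < s * (2 * Z * (χ + χ') - 2 * Z * P ^ 2)
      + P / (2 * m) * ((2 * (1 + Z) * P - 2 * Z * χ) * (2 * (1 + Z) * P + (m - 1) * (2 * Z * χ))) := by
  obtain ⟨h0, h1⟩ := hχ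
  have hP1 : 1 ≤ P := by rw [hP]; have := mul_nonneg (mul_pos hg hZ).le h0; linarith
  have hPχ : 2 * χ ≤ P := by rw [hP]; nlinarith
  have hm0 : 0 < m := by linarith
  have e1 : Z * P ≤ 2 * (1 + Z) * P - 2 * Z * χ := by nlinarith
  have e2 : 2 * Z * P ≤ 2 * (1 + Z) * P + (m - 1) * (2 * Z * χ) := by
    have : 0 ≤ (m - 1) * (2 * Z * χ) := by
      have : 0 ≤ m - 1 := by linarith
      positivity
    nlinarith
  have e3 : P / (2 * m) * (Z * P * (2 * Z * P)) ≤ P / (2 * m) *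
      ((2 * (1 + Z) * P - 2 * Z * χ) * (2 * (1 + Z) * P + (m - 1) * (2 * Z * χ))) := by
    gcongr
    exact le_trans (by positivity) e1
  have e4 : -(s * (4 * Z * P ^ 2)) ≤ s * (2 * Z * (χ + χ') - 2 * Z * P ^ 2) := by
    rw [← mul_neg]
    gcongr
    have := neg_le_of_abs_le hχ'
    have hP2 : 1 ≤ P ^ 2 := one_le_pow₀ hP1
    have := mul_nonneg (mul_pos two_pos hZ).le (by linarith : 0 ≤ χ + χ' + P ^ 2)
    linarith
  have e5 : s * (4 * Z * P ^ 2) < P / (2 * m) * (Z * P * (2 * Z * P)) := by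
    have : P / (2 * m) * (Z * P * (2 * Z * P)) = Z * P ^ 2 / m * (Z * P) := by field_simp
    rw [this]
    calc s * (4 * Z * P ^ 2) = Z * P ^ 2 / m * (4 * s * m) := by field_simp
      _ < Z * P ^ 2 / m * (Z * P) := mul_lt_mul_of_pos_left (by nlinarith) (by positivity)
  linarith

lemma plateau_main_pos {m s g Z P : ℝ} (hm : 2 ≤ m) (hg : 0 < g)
    (hZ : 0 < Z) (hP : P = 1 + g * Z) (hs : s ≤ 4 / (m - 1)) :
    0 < s * (2 * Z - 2 * Z * P ^ 2)
      + P / (2 * m) * ((2 * (1 + Z) * P - 2 * Z) * (2 * (1 + Z) * P + (m - 1) * (2 * Z))) := by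
  have hm0 : 0 < m := by linarith
  have hP1 : 1 < P := by rw [hP]; have := mul_pos hg hZ; linarith
  have hd2 : 0 < P ^ 2 - 1 := by nlinarith
  obtain ⟨d, hd0, hd⟩ : ∃ d : ℝ, 0 < d ∧ d ^ 2 = P ^ 2 - 1 :=
    ⟨√(P ^ 2 - 1), Real.sqrt_pos.2 hd2, Real.sq_sqrt hd2.le⟩
  have hdP : d < P := by nlinarith
  have hms : m * s ≤ 8 := by
    have h1 : 4 / (m - 1) ≤ 8 / m := by
      rw [div_le_div_iff₀ (by linarith) hm0]; linarith
    have := hs.trans h1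
    rw [le_div_iff₀ hm0] at this
    linarith
  have hYP : 0 < (1 + Z) * P - Z := by nlinarith
  have h1 : P * (((1 + Z) * P - Z) * ((1 + Z) * P + Z))
      ≤ P * (((1 + Z) * P - Z) * ((1 + Z) * P + (m - 1) * Z)) := by
    gcongr
    nlinarith
  have h2 : m * s * (Z * d ^ 2) ≤ 8 * (Z * d ^ 2) := by gcongr
  have h3 : 0 < P ^ 2 * (d + P) - 4 * d ^ 2 := by
    have h5 : 2 * d ≤ P ^ 2 := by nlinarith [sq_nonneg (d - 1)]
    have h6 : 2 * d * (d + d) < P ^ 2 * (d + P) := by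
      have : d + d < d + P := by linarith
      exact mul_lt_mul' h5 this (by positivity) (by positivity)
    linarith
  have h4 : 0 ≤ P * (P - d * Z) ^ 2 := by positivity
  have h5 : 0 < -(m * s * (Z * d ^ 2)) + P * (((1 + Z) * P - Z) * ((1 + Z) * P + (m - 1) * Z)) := by
    have h6 := mul_pos hZ h3
    have h7 : P * (((1 + Z) * P - Z) * ((1 + Z) * P + Z))
        = P ^ 3 + 2 * P ^ 3 * Z + P * d ^ 2 * Z ^ 2 := by rw [hd]; ring
    have h8 : P * (P - d * Z) ^ 2 = P ^ 3 + P * d ^ 2 * Z ^ 2 - 2 * (Z * (P ^ 2 * d)) := by ring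
    have h9 : Z * (P ^ 2 * (d + P) - 4 * d ^ 2)
      = Z * (P ^ 2 * d) + P ^ 3 * Z - 4 * (Z * d ^ 2) := by ring
    linarith
  have h6 : s * (2 * Z - 2 * Z * P ^ 2)
      + P / (2 * m) * ((2 * (1 + Z) * P - 2 * Z) * (2 * (1 + Z) * P + (m - 1) * (2 * Z)))
      = 2 / m * (-(m * s * (Z * d ^ 2))
        + P * (((1 + Z) * P - Z) * ((1 + Z) * P + (m - 1) * Z))) := by
    rw [hd]; field_simp; ring
  rw [h6]
  positivity

lemma nonempty_profile_of_two_lt_q {m q s : ℝ} (hm : 2 ≤ m) (hq2 : 2 < q)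
    (hs : 4 / m ≤ s) (hs' : s ≤ 4 / (m - 1)) : Nonempty (BernsteinProfile m q s) := by
  have hm0 : 0 < m := by linarith
  have hs0 : 0 < s := lt_of_lt_of_le (by positivity) hs
  set g := (q - 2) / s with hgdef
  have hg : 0 < g := div_pos (by linarith) hs0
  obtain ⟨χ, hχ, hχs, hχ01, hχd, hχ1⟩ := exists_slow_cutoff
    (|Real.log (1 / (2 * s * m))| + |Real.log (max (4 * s * m) (1 / g))| + 1) 1 one_pos
  have hχdiff : Differentiable ℝ χ := hχ.differentiable (by norm_num)
  have hPpos : ∀ t, 0 < 1 + g * Real.exp t * χ t := fun t => by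
    have := mul_nonneg (mul_pos hg (Real.exp_pos t)).le (hχ01 t).1
    linarith
  have hder : ∀ t, HasDerivAt (fun t => 2 * Real.exp t * χ t / s)
      (2 * Real.exp t * (χ t + deriv χ t) / s) t := fun t =>
    ((((Real.hasDerivAt_exp t).const_mul 2).mul (hχdiff t).hasDerivAt).div_const s).congr_deriv
      (by ring)
  have hμ : ∀ t, 1 + (q / 2 - 1) * (2 * Real.exp t * χ t / s) = 1 + g * Real.exp t * χ t := by
    intro t; rw [hgdef]; field_simp
  refine nonempty_profile_of_slope hm (θ := fun t => 2 * Real.exp t * χ t / s) ?_ ?_ ?_ ?_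
  · exact ContDiff.div_const (by fun_prop) _
  · refine hχs.mono fun t ht => ?_
    contrapose! ht
    simp only [Function.mem_support, not_not] at ht
    simp [ht]
  · intro t
    rw [hμ]
    exact hPpos t
  · intro t
    rw [(hder t).deriv]
    have hZ := Real.exp_pos t
    have hpos : 0 < s * (2 * Real.exp t * (χ t + deriv χ t)
          - 2 * Real.exp t * (1 + g * Real.exp t * χ t) ^ 2)
        + (1 + g * Real.exp t * χ t) / (2 * m)
          * ((2 * (1 + Real.exp t) * (1 + g * Real.exp t * χ t) - 2 * Real.exp t * χ t)
          * (2 * (1 + Real.exp t) * (1 + g * Real.exp t * χ t)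
            + (m - 1) * (2 * Real.exp t * χ t))) := by
      by_cases h1 : 2 * s * m * Real.exp t < 1
      · exact cutoff_main_pos_of_small hm hs0 hg hZ (hχ01 t) (hχd t) rfl h1
      by_cases h2 : max (4 * s * m) (1 / g) < Real.exp t
      · obtain ⟨h3, h4⟩ := max_lt_iff.1 h2
        rw [div_lt_iff₀' hg] at h4
        exact cutoff_main_pos_of_large hm hs0 hg hZ (hχ01 t) (hχd t) rfl h3 h4.le
      rw [not_lt] at h1 h2
      have h3 : Real.log (1 / (2 * s * m)) ≤ t := by
        rw [Real.log_le_iff_le_exp (by positivity), div_le_iff₀ (by positivity)]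
        linarith
      have h4 : t ≤ Real.log (max (4 * s * m) (1 / g)) := by
        rwa [Real.le_log_iff_exp_le (lt_max_of_lt_left (by positivity))]
      obtain ⟨h5, h6⟩ := hχ1 t (by
        rw [abs_lt]
        constructor
        · linarith [neg_abs_le (Real.log (1 / (2 * s * m))),
            abs_nonneg (Real.log (max (4 * s * m) (1 / g)))]
        · linarith [le_abs_self (Real.log (max (4 * s * m) (1 / g))),
            abs_nonneg (Real.log (1 / (2 * s * m)))])
      rw [h5, h6]
      simpa using plateau_main_pos hm hg hZ rfl hs'
    have hP := hPpos t
    have key : bochnerMain m q s (Real.exp t) (2 * Real.exp t * χ t / s)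
        (2 * Real.exp t * (χ t + deriv χ t) / s) * (1 + g * Real.exp t * χ t) ^ 2
        = s * (2 * Real.exp t * (χ t + deriv χ t)
          - 2 * Real.exp t * (1 + g * Real.exp t * χ t) ^ 2)
        + (1 + g * Real.exp t * χ t) / (2 * m)
          * ((2 * (1 + Real.exp t) * (1 + g * Real.exp t * χ t) - 2 * Real.exp t * χ t)
          * (2 * (1 + Real.exp t) * (1 + g * Real.exp t * χ t)
            + (m - 1) * (2 * Real.exp t * χ t))) := by
      have hq : q = 2 + g * s := by rw [hgdef]; field_simp; ring
      rw [bochnerMain, hμ]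
      generalize hPdef : 1 + g * Real.exp t * χ t = P at hP ⊢
      rw [hq]
      have h7 : s * (2 * Real.exp t * χ t / s) = 2 * Real.exp t * χ t := by field_simp
      rw [h7]
      generalize Real.exp t = Z at hPdef ⊢
      field_simp
      subst hPdef
      ring
    exact pos_of_mul_pos_left (key ▸ hpos) (by positivity)

lemma nonempty_profile {m q s : ℝ} (hm : 2 ≤ m) (hq : 0 < q) (hs : s ≤ 4 / (m - 1)) :
    Nonempty (BernsteinProfile m q s) := by
  have hm0 : 0 < m := by linarith
  rcases lt_or_ge s (4 / m) with h | h
  · have h0 : max s 0 / 2 < 2 / m := by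
      have h1 : max s 0 < 4 / m := max_lt h (by positivity)
      have h2 : 4 / m / 2 = 2 / m := by ring
      linarith
    refine ⟨⟨0, 0, 0, min 1 (2 / m - max s 0 / 2), 1, lt_min one_pos (by linarith),
      fun t => hasDerivAt_const t _, fun t => hasDerivAt_const t _, continuous_zero,
      fun t => by simp, fun t => by simp, fun t => by simp, fun t => by simp, fun t => ?_⟩⟩
    simp only [Pi.zero_apply]
    rw [bochnerMain_zero]
    have hZ := Real.exp_pos t
    generalize Real.exp t = Z at hZ
    have h1 : min 1 (2 / m - max s 0 / 2) * (1 + Z) ^ 2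
        ≤ (2 / m - max s 0 / 2) * (1 + Z) ^ 2 := by
      gcongr
      exact min_le_right _ _
    have h2 : s * (4 * Z) ≤ max s 0 * (4 * Z) :=
      mul_le_mul_of_nonneg_right (le_max_left _ _) (by positivity)
    have h3 : max s 0 * (4 * Z) ≤ max s 0 * (1 + Z) ^ 2 := by
      refine mul_le_mul_of_nonneg_left ?_ (le_max_right _ _)
      nlinarith [sq_nonneg (1 - Z)]
    have h4 : 2 * (1 + Z) ^ 2 / m = 2 / m * (1 + Z) ^ 2 := by ring
    linarith
  · rcases le_or_gt q 2 with h2 | h2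
    · exact nonempty_profile_of_q_le_two hm hq h2 h hs
    · exact nonempty_profile_of_two_lt_q hm h2 h hs

lemma nonpos_of_isLocalMax_of_hasDerivAt {v v₁ : ℝ → ℝ} {v₂ : ℝ} (hmax : IsLocalMax v 0)
    (h₁ : ∀ᶠ τ in 𝓝 0, HasDerivAt v (v₁ τ) τ) (h₂ : HasDerivAt v₁ v₂ 0) : v₂ ≤ 0 := by
  by_contra! hpos
  have hd : deriv v =ᶠ[𝓝 0] v₁ := h₁.mono fun τ h => h.deriv
  have hdd : deriv (deriv v) 0 = v₂ := hd.deriv_eq.trans h₂.deriv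
  have hmin : IsLocalMin v 0 :=
    isLocalMin_of_deriv_deriv_pos (hdd ▸ hpos) hmax.deriv_eq_zero h₁.self_of_nhds.continuousAt
  have hconst : v =ᶠ[𝓝 0] fun _ => v 0 := by
    filter_upwards [hmax, hmin] with τ h1 h2 using le_antisymm h1 h2
  have h0 : deriv v =ᶠ[𝓝 0] fun _ => 0 := by
    refine hconst.deriv.trans (Eventually.of_forall fun τ => ?_)
    simp
  rw [h0.deriv_eq, deriv_const] at hdd
  exact hpos.ne hdd

lemma second_order_nonpos {ω θ θ' : ℝ → ℝ} (hω : ∀ t, HasDerivAt ω (θ t) t)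
    (hθ : ∀ t, HasDerivAt θ (θ' t) t) (ρ s : ℝ) {a a₁ b b₁ z z₁ : ℝ → ℝ} {a₂ b₂ z₂ : ℝ}
    (ha : ∀ᶠ τ in 𝓝 0, HasDerivAt a (a₁ τ) τ) (ha₁ : HasDerivAt a₁ a₂ 0)
    (hb : ∀ᶠ τ in 𝓝 0, HasDerivAt b (b₁ τ) τ) (hb₁ : HasDerivAt b₁ b₂ 0)
    (hz : ∀ᶠ τ in 𝓝 0, HasDerivAt z (z₁ τ) τ) (hz₁ : HasDerivAt z₁ z₂ 0) (hpos : 0 < a 0)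
    (hmax : IsLocalMax (fun τ => Real.log (a τ) + ω (ρ * Real.log (a τ) + s * b τ) + z τ) 0) :
    (1 + ρ * θ (ρ * Real.log (a 0) + s * b 0)) * (a₂ / a 0 - (a₁ 0 / a 0) ^ 2)
      + s * θ (ρ * Real.log (a 0) + s * b 0) * b₂
      + θ' (ρ * Real.log (a 0) + s * b 0) * (ρ * (a₁ 0 / a 0) + s * b₁ 0) ^ 2 + z₂ ≤ 0 := by
  have ha0 : HasDerivAt a (a₁ 0) 0 := ha.self_of_nhds
  have hapos : ∀ᶠ τ in 𝓝 0, 0 < a τ := ha0.continuousAt.eventually (lt_mem_nhds hpos)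
  have hl : HasDerivAt (fun τ => a₁ τ / a τ) (a₂ / a 0 - (a₁ 0 / a 0) ^ 2) 0 :=
    (ha₁.div ha0 hpos.ne').congr_deriv (by field_simp)
  have ht : ∀ᶠ τ in 𝓝 0, HasDerivAt (fun τ => ρ * Real.log (a τ) + s * b τ)
      (ρ * (a₁ τ / a τ) + s * b₁ τ) τ := by
    filter_upwards [ha, hb, hapos] with τ h1 h2 h3
    exact ((h1.log h3.ne').const_mul ρ).add (h2.const_mul s)
  have hv : ∀ᶠ τ in 𝓝 0,
      HasDerivAt (fun τ => Real.log (a τ) + ω (ρ * Real.log (a τ) + s * b τ) + z τ)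
        (a₁ τ / a τ + θ (ρ * Real.log (a τ) + s * b τ) * (ρ * (a₁ τ / a τ) + s * b₁ τ) + z₁ τ)
        τ := by
    filter_upwards [ha, ht, hz, hapos] with τ h1 h2 h3 h4
    exact ((h1.log h4.ne').add ((hω _).comp τ h2)).add h3
  have hv₁ := (hl.add (((hθ _).comp 0 ht.self_of_nhds).mul
    ((hl.const_mul ρ).add (hb₁.const_mul s)))).add hz₁
  refine (le_of_eq ?_).trans (nonpos_of_isLocalMax_of_hasDerivAt hmax hv hv₁)
  simp only [Function.comp_apply, Pi.add_apply]
  ring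

lemma eventually_forall_pos {E : Type*} [TopologicalSpace E] {K : Set E} (hK : IsCompact K)
    {W : ℝ → E → ℝ} {W₀ : E → ℝ}
    (hlim : ∀ x ∈ K, Tendsto (fun z : ℝ × E => W z.1 z.2) (𝓝[>] 0 ×ˢ 𝓝 x) (𝓝 (W₀ x)))
    (hpos : ∀ x ∈ K, 0 < W₀ x) : ∀ᶠ δ in 𝓝[>] 0, ∀ x ∈ K, 0 < W δ x := by
  have h : ∀ᶠ δ : ℝ in 𝓝 0, ∀ x ∈ K, 0 < δ → 0 < W δ x := by
    refine hK.eventually_forall_of_forall_eventually fun x hx => ?_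
    obtain ⟨A, hA, B, hB, hAB⟩ :=
      mem_prod_iff.1 ((hlim x hx).eventually (lt_mem_nhds (hpos x hx)))
    have hA' : ∀ᶠ δ : ℝ in 𝓝 0, δ ∈ Ioi (0 : ℝ) → δ ∈ A := mem_nhdsWithin_iff_eventually.1 hA
    filter_upwards [hA'.prod_nhds hB] with z hz hz0
    exact hAB (mk_mem_prod (hz.1 hz0) hz.2)
  filter_upwards [nhdsWithin_le_nhds h, self_mem_nhdsWithin] with δ h1 h2 x hx
  exact h1 x hx h2

lemma frequently_isLocalMax {E : Type*} [MetricSpace E] [ProperSpace E] {V : ℝ → E → ℝ}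
    {V₀ : E → ℝ} {x₁ : E} {r : ℝ}
    (hr : 0 < r) (hmax : ∀ x ∈ Metric.closedBall x₁ r, x ≠ x₁ → V₀ x < V₀ x₁)
    (hlim : ∀ x ∈ Metric.closedBall x₁ r,
      Tendsto (fun z : ℝ × E => V z.1 z.2) (𝓝[>] 0 ×ˢ 𝓝 x) (𝓝 (V₀ x)))
    (hcont : ∀ᶠ δ in 𝓝[>] 0, ContinuousOn (V δ) (Metric.closedBall x₁ r)) :
    ∃ᶠ z in 𝓝[>] (0 : ℝ) ×ˢ 𝓝 x₁, IsLocalMax (V z.1) z.2 := by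
  intro hev
  obtain ⟨U, hU, N, hN, hUN⟩ := mem_prod_iff.1 hev
  obtain ⟨N', hN'N, hN'o, hxN'⟩ := mem_nhds_iff.1 hN
  have hx₁ : x₁ ∈ Metric.closedBall x₁ r := Metric.mem_closedBall_self hr.le
  set K := Metric.closedBall x₁ r \ (N' ∩ Metric.ball x₁ r) with hK
  have hKc : IsCompact K := (isCompact_closedBall x₁ r).diff (hN'o.inter Metric.isOpen_ball)
  have hcmp : ∀ᶠ δ : ℝ in 𝓝[>] 0, ∀ x ∈ K, 0 < V δ x₁ - V δ x := by
    refine eventually_forall_pos hKc (W := fun δ x => V δ x₁ - V δ x)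
      (W₀ := fun x => V₀ x₁ - V₀ x) (fun x hx => ?_) fun x hx => sub_pos.2 (hmax x hx.1 ?_)
    · have hpt : Tendsto (fun z : ℝ × E => (z.1, x₁)) (𝓝[>] 0 ×ˢ 𝓝 x) (𝓝[>] 0 ×ˢ 𝓝 x₁) :=
        tendsto_fst.prodMk tendsto_const_nhds
      exact ((hlim x₁ hx₁).comp hpt).sub (hlim x hx.1)
    · rintro rfl
      exact hx.2 ⟨hxN', Metric.mem_ball_self hr⟩
  obtain ⟨δ, hδ1, hδ2, hδ3⟩ := (hcmp.and (hcont.and hU)).exists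
  obtain ⟨x, hx, hxmax⟩ := (isCompact_closedBall x₁ r).exists_isMaxOn ⟨x₁, hx₁⟩ hδ2
  have hxK : x ∉ K := fun h => (sub_pos.1 (hδ1 x h)).not_ge (hxmax hx₁)
  have hxN : x ∈ N' ∩ Metric.ball x₁ r := by
    by_contra h
    exact hxK ⟨hx, h⟩
  exact hUN (mk_mem_prod hδ3 (hN'N hxN.1))
    (hxmax.isLocalMax (Metric.closedBall_mem_nhds_of_mem hxN.2))

section

variable {E F : Type*} [NormedAddCommGroup E] [NormedSpace ℝ E] [NormedAddCommGroup F]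
  [NormedSpace ℝ F]

lemma tendsto_difference_quotient {f : E → F} {f' : E →L[ℝ] F} {x : E}
    (hf : HasStrictFDerivAt f f' x) {y : E → E} (hy : ContinuousAt y x) :
    Tendsto (fun z : ℝ × E => z.1⁻¹ • (f (z.2 + z.1 • y z.2) - f z.2)) (𝓝[>] 0 ×ˢ 𝓝 x)
      (𝓝 (f' (y x))) := by
  have h1 : Tendsto (fun z : ℝ × E => z.1) (𝓝[>] 0 ×ˢ 𝓝 x) (𝓝 0) :=
    tendsto_fst.mono_right nhdsWithin_le_nhds
  have h2 : Tendsto (fun z : ℝ × E => z.2) (𝓝[>] 0 ×ˢ 𝓝 x) (𝓝 x) := tendsto_snd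
  have hy2 : Tendsto (fun z : ℝ × E => y z.2) (𝓝[>] 0 ×ˢ 𝓝 x) (𝓝 (y x)) := hy.tendsto.comp h2
  have h3 : Tendsto (fun z : ℝ × E => z.2 + z.1 • y z.2) (𝓝[>] 0 ×ˢ 𝓝 x) (𝓝 x) := by
    simpa using h2.add (h1.smul hy2)
  have ho := hf.isLittleO.comp_tendsto (h3.prodMk_nhds h2)
  have hO : (fun z : ℝ × E => z.1 • y z.2) =O[𝓝[>] 0 ×ˢ 𝓝 x] fun z => z.1 := by
    simpa using (Asymptotics.isBigO_refl (fun z : ℝ × E => z.1) _).smul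
      (hy2.isBigO_one ℝ)
  have ho2 : (fun z : ℝ × E => f (z.2 + z.1 • y z.2) - f z.2 - f' (z.1 • y z.2))
      =o[𝓝[>] 0 ×ˢ 𝓝 x] fun z => z.1 := by
    refine Asymptotics.IsLittleO.trans_isBigO ?_ hO
    simpa [Function.comp_def] using ho
  have h4 := (Asymptotics.isLittleO_iff_tendsto' (f := fun z : ℝ × E =>
    ‖f (z.2 + z.1 • y z.2) - f z.2 - f' (z.1 • y z.2)‖) (g := fun z : ℝ × E => z.1) (by
      have : ∀ᶠ z : ℝ × E in 𝓝[>] 0 ×ˢ 𝓝 x, 0 < z.1 :=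
        tendsto_fst.eventually self_mem_nhdsWithin
      filter_upwards [this] with z hz h
      exact absurd h hz.ne')).1 ho2.norm_left
  have h5 : Tendsto (fun z : ℝ × E => z.1⁻¹ • (f (z.2 + z.1 • y z.2) - f z.2) - f' (y z.2))
      (𝓝[>] 0 ×ˢ 𝓝 x) (𝓝 0) := by
    rw [tendsto_zero_iff_norm_tendsto_zero]
    refine h4.congr' ?_
    have : ∀ᶠ z : ℝ × E in 𝓝[>] 0 ×ˢ 𝓝 x, 0 < z.1 :=
      tendsto_fst.eventually self_mem_nhdsWithin
    filter_upwards [this] with z hz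
    have : z.1⁻¹ • (f (z.2 + z.1 • y z.2) - f z.2) - f' (y z.2)
        = z.1⁻¹ • (f (z.2 + z.1 • y z.2) - f z.2 - f' (z.1 • y z.2)) := by
      rw [smul_sub _ (_ - _), map_smul, smul_smul, inv_mul_cancel₀ hz.ne', one_smul]
    rw [this, norm_smul, norm_inv, Real.norm_of_nonneg hz.le, div_eq_inv_mul]
  simpa using h5.add ((f'.continuous.tendsto _).comp hy2)

lemma hasDerivAt_line {f : E → ℝ} {x : E} (v : E) (hf : ContDiffAt ℝ 2 f x) :
    (∀ᶠ τ : ℝ in 𝓝 0, HasDerivAt (fun τ : ℝ => f (x + τ • v)) (fderiv ℝ f (x + τ • v) v) τ) ∧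
      HasDerivAt (fun τ : ℝ => fderiv ℝ f (x + τ • v) v) (fderiv ℝ (fderiv ℝ f) x v v) 0 := by
  have hline : ∀ τ : ℝ, HasDerivAt (fun τ : ℝ => x + τ • v) v τ := fun τ => by
    simpa using ((hasDerivAt_id τ).smul_const v).const_add x
  have htend : Tendsto (fun τ : ℝ => x + τ • v) (𝓝 0) (𝓝 x) := by
    simpa using (hline 0).continuousAt.tendsto
  constructor
  · filter_upwards [htend.eventually (hf.eventually (by simp))] with τ hτ
    exact (hτ.differentiableAt (by norm_num)).hasFDerivAt.comp_hasDerivAt τ (hline τ)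
  · have h1 : DifferentiableAt ℝ (fderiv ℝ f) x :=
      (hf.fderiv_right (m := 1) (by norm_num)).differentiableAt (by norm_num)
    have h2 : HasFDerivAt (fderiv ℝ f) (fderiv ℝ (fderiv ℝ f) x) (x + (0 : ℝ) • v) := by
      simpa using h1.hasFDerivAt
    have h3 : HasDerivAt (fun τ : ℝ => fderiv ℝ f (x + τ • v)) (fderiv ℝ (fderiv ℝ f) x v) 0 :=
      h2.comp_hasDerivAt 0 (hline 0)
    exact (ContinuousLinearMap.apply ℝ ℝ v).hasFDerivAt.comp_hasDerivAt 0 h3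

end

section

variable {E : Type*} [NormedAddCommGroup E] [InnerProductSpace ℝ E]

lemma hasDerivAt_norm_sq_line (a v : E) (τ : ℝ) :
    HasDerivAt (fun τ : ℝ => ‖a + τ • v‖ ^ 2) (2 * inner ℝ (a + τ • v) v) τ := by
  have : HasDerivAt (fun τ : ℝ => a + τ • v) v τ := by
    simpa using ((hasDerivAt_id τ).smul_const v).const_add a
  simpa using this.norm_sq

lemma hasDerivAt_inner_line (a v : E) (τ : ℝ) :
    HasDerivAt (fun τ : ℝ => 2 * inner ℝ (a + τ • v) v) (2 * ‖v‖ ^ 2) τ := by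
  have : HasDerivAt (fun τ : ℝ => a + τ • v) v τ := by
    simpa using ((hasDerivAt_id τ).smul_const v).const_add a
  simpa using (this.inner ℝ (hasDerivAt_const τ v)).const_mul 2

/-- A difference-quotient regularisation of a minorant of `‖∇ h‖ ^ 2`. -/
noncomputable def gradMinorant (h : E → ℝ) (y : E → E) (δ : ℝ) (x : E) : ℝ :=
  2 * (δ⁻¹ * (h (x + δ • y x) - h x)) - ‖y x‖ ^ 2

lemma tendsto_gradMinorant {h : E → ℝ} (hh : ContDiff ℝ 2 h) {y : E → E} (hy : Continuous y)
    (x : E) : Tendsto (fun z : ℝ × E => gradMinorant h y z.1 z.2) (𝓝[>] 0 ×ˢ 𝓝 x)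
      (𝓝 (2 * fderiv ℝ h x (y x) - ‖y x‖ ^ 2)) := by
  have h1 := tendsto_difference_quotient (hh.contDiffAt.hasStrictFDerivAt (by norm_num))
    (hy.continuousAt (x := x))
  exact (h1.const_mul 2).sub ((hy.norm.pow 2).continuousAt.tendsto.comp tendsto_snd)

lemma continuous_gradMinorant {h : E → ℝ} (hh : Continuous h) {y : E → E} (hy : Continuous y)
    (δ : ℝ) : Continuous (gradMinorant h y δ) := by
  unfold gradMinorant
  fun_prop

lemma hasDerivAt_gradMinorant_line {h : E → ℝ} (hh : ContDiff ℝ 2 h) (y₀ x₁ : E) (S : E →L[ℝ] E)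
    (δ : ℝ) (x v : E) :
    (∀ᶠ τ : ℝ in 𝓝 0, HasDerivAt
      (fun τ : ℝ => gradMinorant h (fun x => y₀ + S (x - x₁)) δ (x + τ • v))
      (2 * (δ⁻¹ * (fderiv ℝ h (x + δ • (y₀ + S (x - x₁)) + τ • (v + δ • S v)) (v + δ • S v)
        - fderiv ℝ h (x + τ • v) v)) - 2 * inner ℝ (y₀ + S (x - x₁) + τ • S v) (S v)) τ) ∧
    HasDerivAt (fun τ : ℝ =>
      2 * (δ⁻¹ * (fderiv ℝ h (x + δ • (y₀ + S (x - x₁)) + τ • (v + δ • S v)) (v + δ • S v)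
        - fderiv ℝ h (x + τ • v) v)) - 2 * inner ℝ (y₀ + S (x - x₁) + τ • S v) (S v))
      (2 * (δ⁻¹ * (fderiv ℝ (fderiv ℝ h) (x + δ • (y₀ + S (x - x₁))) (v + δ • S v) (v + δ • S v)
        - fderiv ℝ (fderiv ℝ h) x v v)) - 2 * ‖S v‖ ^ 2) 0 := by
  obtain ⟨h1, h1'⟩ := hasDerivAt_line (f := h) (x := x + δ • (y₀ + S (x - x₁))) (v + δ • S v)
    hh.contDiffAt
  obtain ⟨h2, h2'⟩ := hasDerivAt_line (f := h) (x := x) v hh.contDiffAt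
  constructor
  · filter_upwards [h1, h2] with τ h3 h4
    have h5 := (((h3.sub h4).const_mul δ⁻¹).const_mul 2).sub
      (hasDerivAt_norm_sq_line (y₀ + S (x - x₁)) (S v) τ)
    refine h5.congr_of_eventuallyEq (Eventually.of_forall fun τ => ?_)
    have e1 : y₀ + S (x + τ • v - x₁) = y₀ + S (x - x₁) + τ • S v := by
      rw [add_sub_right_comm, map_add, map_smul, add_assoc]
    have e2 : x + τ • v + δ • (y₀ + S (x - x₁) + τ • S v)
        = x + δ • (y₀ + S (x - x₁)) + τ • (v + δ • S v) := by
      module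
    simp only [gradMinorant, e1, e2, Pi.sub_apply]
  · exact (((h1'.sub h2').const_mul δ⁻¹).const_mul 2).sub (hasDerivAt_inner_line _ _ _)

end

section

variable {E : Type*} [NormedAddCommGroup E] [InnerProductSpace ℝ E]
  {ι : Type*} [Fintype ι]

lemma gradMinorant_second_order {h g ζ : E → ℝ} (hh : ContDiff ℝ 2 h)
    (b : OrthonormalBasis ι ℝ E)
    (hg : ∀ x, ∑ i, fderiv ℝ (fderiv ℝ h) x (b i) (b i) = g x) {ω θ θ' : ℝ → ℝ}
    (hω : ∀ t, HasDerivAt ω (θ t) t) (hθ : ∀ t, HasDerivAt θ (θ' t) t) (ρ s ε : ℝ) {δ : ℝ}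
    (hδ : δ ≠ 0) (y₀ x₁ : E) (S : E →L[ℝ] E) {x y : E} {w t : ℝ} {l : ι → ℝ}
    (hζ : ContDiffAt ℝ 2 ζ x) (hy : y = y₀ + S (x - x₁))
    (hw : w = gradMinorant h (fun x => y₀ + S (x - x₁)) δ x)
    (ht : t = ρ * Real.log w + s * h x)
    (hl : ∀ i, l i = (2 * (δ⁻¹ * (fderiv ℝ h (x + δ • y) (b i + δ • S (b i))
      - fderiv ℝ h x (b i))) - 2 * inner ℝ y (S (b i))) / w)
    (hpos : 0 < w)
    (hmax : IsLocalMax (fun x =>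
      Real.log (gradMinorant h (fun x => y₀ + S (x - x₁)) δ x)
        + ω (ρ * Real.log (gradMinorant h (fun x => y₀ + S (x - x₁)) δ x) + s * h x)
        + (ζ x - ε * ‖x - x₁‖ ^ 2)) x) :
    (1 + ρ * θ t) * ((2 * (δ⁻¹ * (g (x + δ • y) - g x))
        + 4 * ∑ i, fderiv ℝ (fderiv ℝ h) (x + δ • y) (b i) (S (b i))
        + 2 * δ * ∑ i, fderiv ℝ (fderiv ℝ h) (x + δ • y) (S (b i)) (S (b i))
        - 2 * ∑ i, ‖S (b i)‖ ^ 2) / w - ∑ i, l i ^ 2)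
      + s * θ t * g x + θ' t * ∑ i, (ρ * l i + s * fderiv ℝ h x (b i)) ^ 2
      + ∑ i, fderiv ℝ (fderiv ℝ ζ) x (b i) (b i) - ε * (2 * Fintype.card ι) ≤ 0 := by
  have key : ∀ i, (1 + ρ * θ t) * ((2 * (δ⁻¹ *
        (fderiv ℝ (fderiv ℝ h) (x + δ • y) (b i + δ • S (b i)) (b i + δ • S (b i))
        - fderiv ℝ (fderiv ℝ h) x (b i) (b i))) - 2 * ‖S (b i)‖ ^ 2) / w - l i ^ 2)
      + s * θ t * fderiv ℝ (fderiv ℝ h) x (b i) (b i)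
      + θ' t * (ρ * l i + s * fderiv ℝ h x (b i)) ^ 2
      + (fderiv ℝ (fderiv ℝ ζ) x (b i) (b i) - ε * (2 * ‖b i‖ ^ 2)) ≤ 0 := by
    intro i
    obtain ⟨ha, ha'⟩ := hasDerivAt_gradMinorant_line hh y₀ x₁ S δ x (b i)
    obtain ⟨hb, hb'⟩ := hasDerivAt_line (f := h) (x := x) (b i) hh.contDiffAt
    obtain ⟨hz, hz'⟩ := hasDerivAt_line (f := ζ) (x := x) (b i) hζ
    have hn : ∀ τ : ℝ, HasDerivAt (fun τ : ℝ => ε * ‖x + τ • b i - x₁‖ ^ 2)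
        (ε * (2 * inner ℝ (x - x₁ + τ • b i) (b i))) τ := fun τ => by
      simpa only [add_sub_right_comm] using
        (hasDerivAt_norm_sq_line (x - x₁) (b i) τ).const_mul ε
    have hline : Tendsto (fun τ : ℝ => x + τ • b i) (𝓝 0) (𝓝 (x + (0 : ℝ) • b i)) := by
      have : Continuous fun τ : ℝ => x + τ • b i := by fun_prop
      exact this.tendsto 0
    rw [zero_smul, add_zero] at hline
    have hm := hline.eventually hmax
    have hw0 : w = gradMinorant h (fun x => y₀ + S (x - x₁)) δ (x + (0 : ℝ) • b i) := by
      rw [hw, zero_smul, add_zero]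
    have hso := second_order_nonpos hω hθ ρ s ha ha' hb hb'
      (hz.mono fun τ h1 => h1.sub (hn τ))
      (hz'.sub ((hasDerivAt_inner_line (x - x₁) (b i) 0).const_mul ε))
      (hw0 ▸ hpos) (by simpa only [IsLocalMax, IsMaxFilter, zero_smul, add_zero, Pi.sub_apply] using hm)
    simp only [zero_smul, add_zero, ← hy, ← hw, ← ht, ← hl] at hso
    exact hso
  have hsum := Finset.sum_nonpos fun i (_ : i ∈ Finset.univ) => key i
  have hexp : ∀ i, 2 * (δ⁻¹ *
        (fderiv ℝ (fderiv ℝ h) (x + δ • y) (b i + δ • S (b i)) (b i + δ • S (b i))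
        - fderiv ℝ (fderiv ℝ h) x (b i) (b i))) - 2 * ‖S (b i)‖ ^ 2
      = 2 * (δ⁻¹ * (fderiv ℝ (fderiv ℝ h) (x + δ • y) (b i) (b i)
          - fderiv ℝ (fderiv ℝ h) x (b i) (b i)))
        + 4 * fderiv ℝ (fderiv ℝ h) (x + δ • y) (b i) (S (b i))
        + 2 * δ * fderiv ℝ (fderiv ℝ h) (x + δ • y) (S (b i)) (S (b i)) - 2 * ‖S (b i)‖ ^ 2 := by
    intro i
    have hsymm : fderiv ℝ (fderiv ℝ h) (x + δ • y) (S (b i)) (b i)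
        = fderiv ℝ (fderiv ℝ h) (x + δ • y) (b i) (S (b i)) :=
      (hh.contDiffAt.isSymmSndFDerivAt (by simp)).eq _ _
    simp only [map_add, map_smul, add_apply, smul_apply,
      smul_eq_mul, hsymm]
    field_simp
    ring
  refine (le_of_eq ?_).trans hsum
  simp only [hexp, b.norm_eq_one, Finset.sum_add_distrib, Finset.sum_sub_distrib,
    ← Finset.mul_sum, ← Finset.sum_div, hg, one_pow, mul_one, Finset.sum_const, Finset.card_univ,
    nsmul_eq_mul]
  ring

end

section

variable {E : Type*} [NormedAddCommGroup E] [InnerProductSpace ℝ E]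
  {ι : Type*} [Fintype ι]

lemma sum_inner_mul_apply (b : OrthonormalBasis ι ℝ E) (L : E →L[ℝ] ℝ) (v : E) :
    ∑ i, inner ℝ (b i) v * L (b i) = L v := by
  conv_rhs => rw [← b.sum_repr' v]
  simp [map_sum]

lemma exists_inner_eq_bilin (b : OrthonormalBasis ι ℝ E) (B : E →L[ℝ] E →L[ℝ] ℝ) :
    ∃ S : E →L[ℝ] E, ∀ v w, inner ℝ (S v) w = B v w := by
  refine ⟨∑ i, ((ContinuousLinearMap.apply ℝ ℝ (b i)).comp B).smulRight (b i), fun v w => ?_⟩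
  rw [← sum_inner_mul_apply b (B v) w]
  simp [sum_inner, inner_smul_left, mul_comm]

lemma sum_inner_sq (b : OrthonormalBasis ι ℝ E) (v : E) :
    ∑ i, inner ℝ (b i) v ^ 2 = ‖v‖ ^ 2 := by
  simpa using b.sum_sq_norm_inner_right v

lemma two_mul_apply_sub_norm_sq_le (b : OrthonormalBasis ι ℝ E) (L : E →L[ℝ] ℝ) (v : E) :
    2 * L v - ‖v‖ ^ 2 ≤ ∑ i, L (b i) ^ 2 := by
  rw [← sum_inner_mul_apply b L v, ← sum_inner_sq b v, Finset.mul_sum, ← Finset.sum_sub_distrib]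
  exact Finset.sum_le_sum fun i _ => by nlinarith [sq_nonneg (inner ℝ (b i) v - L (b i))]

lemma sum_apply_sq_eq (b : OrthonormalBasis ι ℝ E) {L : E →L[ℝ] ℝ} {v : E}
    (hv : ∀ w, inner ℝ v w = L w) : ∑ i, L (b i) ^ 2 = ‖v‖ ^ 2 := by
  rw [← sum_inner_sq b v]
  exact Finset.sum_congr rfl fun i _ => by rw [← hv, real_inner_comm]

lemma monotone_add_comp {ω θ : ℝ → ℝ} (hω : ∀ t, HasDerivAt ω (θ t) t) {ρ : ℝ}
    (hμ : ∀ t, 0 < 1 + ρ * θ t) (a : ℝ) : Monotone fun L => L + ω (ρ * L + a) := by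
  have hd : ∀ L, HasDerivAt (fun L => L + ω (ρ * L + a)) (1 + θ (ρ * L + a) * ρ) L := fun L => by
    have h1 : HasDerivAt (fun L => ρ * L + a) ρ L := by
      simpa using ((hasDerivAt_id L).const_mul ρ).add_const a
    exact (hasDerivAt_id L).add ((hω _).comp L h1)
  refine monotone_of_deriv_nonneg (fun L => (hd L).differentiableAt) fun L => ?_
  rw [(hd L).deriv]
  have := hμ (ρ * L + a)
  linarith

lemma bochner_second_order [FiniteDimensional ℝ E] {h g ζ : E → ℝ} (hh : ContDiff ℝ 2 h)
    (b : OrthonormalBasis ι ℝ E)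
    (hg : ∀ x, ∑ i, fderiv ℝ (fderiv ℝ h) x (b i) (b i) = g x)
    {x₁ y : E} {g' : E →L[ℝ] ℝ} (hg' : HasStrictFDerivAt g g' x₁)
    (hy : ∀ v, inner ℝ y v = fderiv ℝ h x₁ v) (hy0 : y ≠ 0) {ω θ θ' : ℝ → ℝ}
    (hω : ∀ t, HasDerivAt ω (θ t) t) (hθ : ∀ t, HasDerivAt θ (θ' t) t) (hθ' : Continuous θ')
    {ρ s : ℝ} (hμ : ∀ t, 0 < 1 + ρ * θ t) (hζ : ContDiffAt ℝ 2 ζ x₁)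
    (hmax : IsLocalMax (fun x => Real.log (∑ i, fderiv ℝ h x (b i) ^ 2)
      + ω (ρ * Real.log (∑ i, fderiv ℝ h x (b i) ^ 2) + s * h x) + ζ x) x₁)
    {t : ℝ} (ht : t = ρ * Real.log (‖y‖ ^ 2) + s * h x₁) {l : ι → ℝ}
    (hl : ∀ i, l i = 2 * fderiv ℝ (fderiv ℝ h) x₁ y (b i) / ‖y‖ ^ 2) :
    (1 + ρ * θ t) * ((2 * g' y
        + 2 * ∑ i, ∑ j, fderiv ℝ (fderiv ℝ h) x₁ (b i) (b j) ^ 2) / ‖y‖ ^ 2 - ∑ i, l i ^ 2)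
      + s * θ t * g x₁ + θ' t * ∑ i, (ρ * l i + s * fderiv ℝ h x₁ (b i)) ^ 2
      + ∑ i, fderiv ℝ (fderiv ℝ ζ) x₁ (b i) (b i) ≤ 0 := by
  have : ProperSpace E := FiniteDimensional.proper ℝ E
  set B := fderiv ℝ (fderiv ℝ h) x₁ with hB
  obtain ⟨S, hS⟩ := exists_inner_eq_bilin b B
  have hH1 : ∑ i, fderiv ℝ h x₁ (b i) ^ 2 = ‖y‖ ^ 2 := sum_apply_sq_eq b hy
  have hypos : 0 < ‖y‖ ^ 2 := by positivity
  have hdh : Continuous (fderiv ℝ h) := hh.continuous_fderiv (by norm_num)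
  have hDh : ContDiff ℝ 1 (fderiv ℝ h) := hh.fderiv_right (by norm_num)
  have hddh : Continuous (fderiv ℝ (fderiv ℝ h)) := hDh.continuous_fderiv (by norm_num)
  have hωc : Continuous ω := continuous_iff_continuousAt.2 fun t => (hω t).continuousAt
  have hθc : Continuous θ := continuous_iff_continuousAt.2 fun t => (hθ t).continuousAt
  set Y : E → E := fun x => y + S (x - x₁) with hY
  have hYc : Continuous Y := by fun_prop
  have hY1 : Y x₁ = y := by simp [hY]
  set W₀ : E → ℝ := fun x => 2 * fderiv ℝ h x (Y x) - ‖Y x‖ ^ 2 with hW₀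
  have hW₀c : Continuous W₀ := by fun_prop
  have hW₀1 : W₀ x₁ = ‖y‖ ^ 2 := by
    simp only [hW₀, hY1, ← hy, real_inner_self_eq_norm_sq]; ring
  refine le_of_forall_pos_le_add fun ε' hε' => ?_
  obtain ⟨ε, hε, hεε'⟩ : ∃ ε > 0, ε * (2 * Fintype.card ι) ≤ ε' := by
    refine ⟨ε' / (2 * Fintype.card ι + 1), by positivity, ?_⟩
    rw [div_mul_eq_mul_div, div_le_iff₀ (by positivity)]
    nlinarith
  have hev : ∀ᶠ x in 𝓝 x₁, _ ∧ 0 < W₀ x ∧ ContDiffAt ℝ 2 ζ x := hmax.and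
    ((hW₀c.continuousAt.eventually (lt_mem_nhds (hW₀1 ▸ hypos))).and (hζ.eventually (by simp)))
  obtain ⟨r, hr, hball⟩ := Metric.nhds_basis_closedBall.eventually_iff.1 hev
  have hlimW : ∀ x, Tendsto (fun z : ℝ × E => gradMinorant h Y z.1 z.2) (𝓝[>] 0 ×ˢ 𝓝 x)
      (𝓝 (W₀ x)) := fun x => tendsto_gradMinorant hh hYc x
  have hfreq : ∃ᶠ z in 𝓝[>] (0 : ℝ) ×ˢ 𝓝 x₁, IsLocalMax (fun x =>
      Real.log (gradMinorant h Y z.1 x) + ω (ρ * Real.log (gradMinorant h Y z.1 x) + s * h x)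
        + (ζ x - ε * ‖x - x₁‖ ^ 2)) z.2 := by
    refine frequently_isLocalMax (V := fun δ x => Real.log (gradMinorant h Y δ x)
        + ω (ρ * Real.log (gradMinorant h Y δ x) + s * h x) + (ζ x - ε * ‖x - x₁‖ ^ 2))
      (V₀ := fun x => Real.log (W₀ x) + ω (ρ * Real.log (W₀ x) + s * h x)
        + (ζ x - ε * ‖x - x₁‖ ^ 2)) hr ?_ ?_ ?_
    · intro x hx hne
      obtain ⟨h1, h2, -⟩ := hball hx
      have h3 : W₀ x ≤ ∑ i, fderiv ℝ h x (b i) ^ 2 := two_mul_apply_sub_norm_sq_le b _ _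
      have h4 := monotone_add_comp hω hμ (s * h x) (Real.log_le_log h2 h3)
      have h5 : 0 < ε * ‖x - x₁‖ ^ 2 := by
        have := norm_pos_iff.2 (sub_ne_zero.2 hne)
        positivity
      simp only [hW₀1, sub_self, norm_zero, hH1] at h1 h4 ⊢
      linarith
    · intro x hx
      obtain ⟨-, h2, h3⟩ := hball hx
      have e1 := (hlimW x).log h2.ne'
      have e2 : Tendsto (fun z : ℝ × E => h z.2) (𝓝[>] 0 ×ˢ 𝓝 x) (𝓝 (h x)) :=
        hh.continuous.continuousAt.tendsto.comp tendsto_snd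
      have e3 : Tendsto (fun z : ℝ × E => ζ z.2 - ε * ‖z.2 - x₁‖ ^ 2) (𝓝[>] 0 ×ˢ 𝓝 x)
          (𝓝 (ζ x - ε * ‖x - x₁‖ ^ 2)) := by
        have : ContinuousAt (fun x => ζ x - ε * ‖x - x₁‖ ^ 2) x :=
          h3.continuousAt.sub (by fun_prop)
        exact this.tendsto.comp tendsto_snd
      exact (e1.add ((hωc.tendsto _).comp ((e1.const_mul ρ).add (e2.const_mul s)))).add e3
    · filter_upwards [eventually_forall_pos (isCompact_closedBall x₁ r)
        (fun x _ => hlimW x) fun x hx => (hball hx).2.1] with δ hδ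
      have e1 : ContinuousOn (fun x => Real.log (gradMinorant h Y δ x)) (Metric.closedBall x₁ r) :=
        (continuous_gradMinorant hh.continuous hYc δ).continuousOn.log fun x hx => (hδ x hx).ne'
      have e2 : ContinuousOn ζ (Metric.closedBall x₁ r) := fun x hx =>
        (hball hx).2.2.continuousAt.continuousWithinAt
      have e3 : ContinuousOn h (Metric.closedBall x₁ r) := hh.continuous.continuousOn
      exact (e1.add (hωc.comp_continuousOn ((continuousOn_const.mul e1).add
        (continuousOn_const.mul e3)))).add (e2.sub (by fun_prop))
  have hz0 : ∀ᶠ z : ℝ × E in 𝓝[>] 0 ×ˢ 𝓝 x₁, 0 < z.1 :=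
    tendsto_fst.eventually self_mem_nhdsWithin
  have hzw := (hlimW x₁).eventually (lt_mem_nhds (hW₀1 ▸ hypos))
  have hzζ : ∀ᶠ z : ℝ × E in 𝓝[>] 0 ×ˢ 𝓝 x₁, ContDiffAt ℝ 2 ζ z.2 :=
    tendsto_snd.eventually (hζ.eventually (by simp))
  set lz : ι → ℝ × E → ℝ := fun i z =>
    (2 * (z.1⁻¹ * (fderiv ℝ h (z.2 + z.1 • Y z.2) (b i + z.1 • S (b i)) - fderiv ℝ h z.2 (b i)))
      - 2 * inner ℝ (Y z.2) (S (b i))) / gradMinorant h Y z.1 z.2 with hlz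
  set tz : ℝ × E → ℝ := fun z => ρ * Real.log (gradMinorant h Y z.1 z.2) + s * h z.2 with htz
  have hfreq' := (hfreq.and_eventually (hz0.and (hzw.and hzζ))).mono fun z hz =>
    gradMinorant_second_order hh b hg hω hθ ρ s ε hz.2.1.ne' y x₁ S (l := fun i => lz i z)
      (t := tz z) hz.2.2.2 rfl rfl rfl (fun i => rfl) hz.2.2.1 hz.1
  have h1 : Tendsto (fun z : ℝ × E => z.1) (𝓝[>] 0 ×ˢ 𝓝 x₁) (𝓝 0) :=
    tendsto_fst.mono_right nhdsWithin_le_nhds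
  have h2 : Tendsto (fun z : ℝ × E => z.2) (𝓝[>] 0 ×ˢ 𝓝 x₁) (𝓝 x₁) := tendsto_snd
  have hYt : Tendsto (fun z : ℝ × E => Y z.2) (𝓝[>] 0 ×ˢ 𝓝 x₁) (𝓝 y) := by
    exact (hY1 ▸ hYc.tendsto x₁).comp h2
  have hX : Tendsto (fun z : ℝ × E => z.2 + z.1 • Y z.2) (𝓝[>] 0 ×ˢ 𝓝 x₁) (𝓝 x₁) := by
    simpa using h2.add (h1.smul hYt)
  have hwt := hW₀1 ▸ hlimW x₁
  have htt : Tendsto tz (𝓝[>] 0 ×ˢ 𝓝 x₁) (𝓝 t) := by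
    rw [ht]
    exact ((hwt.log hypos.ne').const_mul ρ).add
      (((hh.continuous.tendsto x₁).comp h2).const_mul s)
  have hDX : ∀ v, Tendsto (fun z : ℝ × E => fderiv ℝ h (z.2 + z.1 • Y z.2) v) (𝓝[>] 0 ×ˢ 𝓝 x₁)
      (𝓝 (fderiv ℝ h x₁ v)) := fun v =>
    ((hdh.clm_apply continuous_const).tendsto x₁).comp hX
  have hBX : ∀ v w, Tendsto (fun z : ℝ × E => fderiv ℝ (fderiv ℝ h) (z.2 + z.1 • Y z.2) v w)
      (𝓝[>] 0 ×ˢ 𝓝 x₁) (𝓝 (B v w)) := fun v w =>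
    (((hddh.clm_apply continuous_const).clm_apply continuous_const).tendsto x₁).comp hX
  have hlt : ∀ i, Tendsto (lz i) (𝓝[>] 0 ×ˢ 𝓝 x₁) (𝓝 (l i)) := by
    intro i
    have hq := tendsto_difference_quotient (hDh.contDiffAt.hasStrictFDerivAt (by norm_num))
      (hYc.continuousAt (x := x₁))
    have hq' : Tendsto (fun z : ℝ × E =>
        (z.1⁻¹ • (fderiv ℝ h (z.2 + z.1 • Y z.2) - fderiv ℝ h z.2)) (b i))
        (𝓝[>] 0 ×ˢ 𝓝 x₁) (𝓝 (B y (b i))) := by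
      rw [hY1] at hq
      exact ((ContinuousLinearMap.apply ℝ ℝ (b i)).continuous.tendsto _).comp hq
    have hin : Tendsto (fun z : ℝ × E => inner ℝ (Y z.2) (S (b i))) (𝓝[>] 0 ×ˢ 𝓝 x₁)
        (𝓝 (fderiv ℝ h x₁ (S (b i)))) := by
      rw [← hy]
      exact hYt.inner tendsto_const_nhds
    have := (((hq'.const_mul 2).add ((hDX (S (b i))).const_mul 2)).sub
      (hin.const_mul 2)).div hwt hypos.ne'
    rw [add_sub_cancel_right, ← hl] at this
    refine this.congr' ?_
    filter_upwards [hz0] with z hz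
    simp only [hlz, Pi.div_apply, map_add, map_smul, smul_apply, sub_apply, smul_eq_mul]
    congr 1
    field_simp
    ring
  have hgt : Tendsto (fun z : ℝ × E => z.1⁻¹ * (g (z.2 + z.1 • Y z.2) - g z.2))
      (𝓝[>] 0 ×ˢ 𝓝 x₁) (𝓝 (g' y)) := by
    simpa [hY1] using tendsto_difference_quotient hg' (hYc.continuousAt (x := x₁))
  have hgc : Tendsto (fun z : ℝ × E => g z.2) (𝓝[>] 0 ×ˢ 𝓝 x₁) (𝓝 (g x₁)) :=
    hg'.continuousAt.tendsto.comp h2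
  have hζ2 : ∀ v, Tendsto (fun z : ℝ × E => fderiv ℝ (fderiv ℝ ζ) z.2 v v) (𝓝[>] 0 ×ˢ 𝓝 x₁)
      (𝓝 (fderiv ℝ (fderiv ℝ ζ) x₁ v v)) := by
    intro v
    have e1 : ContDiffAt ℝ 1 (fderiv ℝ ζ) x₁ := hζ.fderiv_right (by norm_num)
    have e2 : ContinuousAt (fderiv ℝ (fderiv ℝ ζ)) x₁ :=
      (e1.fderiv_right (m := 0) (by norm_num)).continuousAt
    exact ((e2.clm_apply continuousAt_const).clm_apply continuousAt_const).tendsto.comp h2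
  have hDh2 : ∀ v, Tendsto (fun z : ℝ × E => fderiv ℝ h z.2 v) (𝓝[>] 0 ×ˢ 𝓝 x₁)
      (𝓝 (fderiv ℝ h x₁ v)) := fun v =>
    ((hdh.clm_apply continuous_const).tendsto x₁).comp h2
  have hsumS : ∑ i, B (b i) (S (b i)) = ∑ i, ‖S (b i)‖ ^ 2 :=
    Finset.sum_congr rfl fun i _ => by rw [← hS, real_inner_self_eq_norm_sq]
  have hsumB : ∑ i, ∑ j, B (b i) (b j) ^ 2 = ∑ i, ‖S (b i)‖ ^ 2 :=
    Finset.sum_congr rfl fun i _ => sum_apply_sq_eq b (hS (b i))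
  have hnum := (((hgt.const_mul 2).add
      ((tendsto_finsetSum Finset.univ fun i _ => hBX (b i) (S (b i))).const_mul 4)).add
      ((h1.const_mul 2).mul
        (tendsto_finsetSum Finset.univ fun i _ => hBX (S (b i)) (S (b i))))).sub
      (tendsto_const_nhds (x := 2 * ∑ i, ‖S (b i)‖ ^ 2))
  have hlsum := tendsto_finsetSum Finset.univ fun i _ => (hlt i).pow 2
  have hlDsum := tendsto_finsetSum Finset.univ fun i _ =>
    (((hlt i).const_mul ρ).add ((hDh2 (b i)).const_mul s)).pow 2
  have hζsum := tendsto_finsetSum Finset.univ fun i _ => hζ2 (b i)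
  have hθt := (hθc.tendsto t).comp htt
  have hlim := ((((((hθt.const_mul ρ).const_add 1).mul ((hnum.div hwt hypos.ne').sub hlsum)).add
    ((hθt.const_mul s).mul hgc)).add (((hθ'.tendsto t).comp htt).mul hlDsum)).add hζsum).sub
    (tendsto_const_nhds (x := ε * (2 * Fintype.card ι)))
  have hle := le_of_tendsto_of_frequently hlim hfreq'
  rw [hsumS] at hle
  rw [hsumB]
  have e : 2 * g' y + 4 * ∑ i, ‖S (b i)‖ ^ 2 + 2 * 0 * ∑ i, B (S (b i)) (S (b i))
      - 2 * ∑ i, ‖S (b i)‖ ^ 2 = 2 * g' y + 2 * ∑ i, ‖S (b i)‖ ^ 2 := by ring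
  rw [e] at hle
  linarith

end

set_option maxHeartbeats 1000000 in
lemma bernstein_algebra {m q s : ℝ} (hm : 0 < m) (hq : 0 ≤ q) (Φ : BernsteinProfile m q s) :
    ∃ C, 0 ≤ C ∧ ∀ t H P d N Nl A Q L Z μ : ℝ, 0 < H → 0 ≤ N → Z = Real.exp t →
      μ = 1 + (q / 2 - 1) * Φ.θ t → P = -(s * Φ.θ t / μ) * H + d → (μ * d) ^ 2 ≤ H * N →
      Nl = (s * Φ.θ t / μ) ^ 2 * H - 2 * (s * Φ.θ t / μ) * d + N / μ ^ 2 →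
      Q = (s / μ) ^ 2 * H + 2 * (s / μ) * (q / 2 - 1) * d + (q / 2 - 1) ^ 2 * N / μ ^ 2 →
      P ^ 2 / 4 + (H * (1 + Z) + P / 2) ^ 2 / m ≤ A →
      μ * ((2 * (-(1 + q / 2 * Z) * H * P - s * Z * H ^ 2) + 2 * A) / H - Nl)
        + s * Φ.θ t * (-(H * (1 + Z))) + Φ.θ' t * Q + L ≤ 0 →
      Φ.c / 2 * H ≤ C * N - L := by
  have hM : 0 ≤ Φ.M := (abs_nonneg _).trans (Φ.abs_θ_le 0)
  have hc := Φ.c_pos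
  set c := Φ.c with hcdef
  set M := Φ.M with hMdef
  set ρ := q / 2 - 1 with hρ
  set C₁ := |s| * M * (1 + 1 / m) + (1 + |ρ| * M) * (2 / m + (2 + q)) + 2 * M * |s| * |ρ| / c
    with hC₁
  set C₂ := 1 / c + M * ρ ^ 2 / c ^ 2 with hC₂
  have hC₁0 : 0 ≤ C₁ := by positivity
  have hC₂0 : 0 ≤ C₂ := by positivity
  refine ⟨C₁ ^ 2 / (2 * c ^ 3) + C₂, by positivity, ?_⟩
  intro t H P d N Nl A Q L Z μ hH hN hZ hμ hP hd hNl hQ hA hineq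
  have hθ := Φ.abs_θ_le t
  have hθ' := Φ.abs_θ'_le t
  have hcμ : c ≤ μ := by rw [hμ]; exact Φ.le_slope t
  have hμ0 : 0 < μ := hc.trans_le hcμ
  have hmain := Φ.le_main t
  rw [← hZ] at hmain
  have hZ0 : 0 < Z := hZ ▸ Real.exp_pos t
  have hsμ : s - ρ * (s * Φ.θ t / μ) = s / μ := by
    field_simp
    rw [hμ]; ring
  set θ := Φ.θ t
  set θ' := Φ.θ' t
  set E₁ := s * θ * (1 - 1 / m) + μ * (2 * (1 + Z) / m - (2 + q * Z)) + 2 * θ' * s * ρ / μ with hE₁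
  set E₂ := -1 / μ + θ' * ρ ^ 2 / μ ^ 2 with hE₂
  have hexp : H * bochnerMain m q s Z θ θ' + E₁ * d + E₂ * N + μ * d ^ 2 * (1 + 1 / m) / (2 * H) + L
      ≤ 0 := by
    refine le_trans ?_ hineq
    have h1 : μ * ((2 * (-(1 + q / 2 * Z) * H * P - s * Z * H ^ 2)
        + 2 * (P ^ 2 / 4 + (H * (1 + Z) + P / 2) ^ 2 / m)) / H - Nl)
        ≤ μ * ((2 * (-(1 + q / 2 * Z) * H * P - s * Z * H ^ 2) + 2 * A) / H - Nl) := by gcongr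
    refine le_trans (le_of_eq ?_) (add_le_add_left (add_le_add_left (add_le_add_left h1 _) _) _)
    rw [bochnerMain, ← hρ, ← hμ, hNl, hQ, hE₁, hE₂, hP]
    clear_value θ θ' ρ
    field_simp
    ring
  have hE₁le : |E₁| ≤ C₁ * (1 + Z) := by
    have a1 : |s * θ * (1 - 1 / m)| ≤ |s| * M * (1 + 1 / m) := by
      rw [abs_mul, abs_mul]
      gcongr
      exact (abs_sub _ _).trans (by rw [abs_one, abs_of_pos (by positivity : 0 < 1 / m)])
    have a2 : μ ≤ 1 + |ρ| * M := by
      rw [hμ]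
      have : ρ * θ ≤ |ρ| * M := (le_abs_self _).trans (by rw [abs_mul]; gcongr)
      linarith
    have a3 : |μ * (2 * (1 + Z) / m - (2 + q * Z))|
        ≤ (1 + |ρ| * M) * (2 / m * (1 + Z) + (2 + q) * (1 + Z)) := by
      rw [abs_mul, abs_of_pos hμ0]
      gcongr
      refine (abs_sub _ _).trans (add_le_add (le_of_eq ?_) ?_)
      · rw [abs_of_pos (by positivity)]; ring
      · rw [abs_of_pos (by positivity)]; linarith [mul_nonneg hq hZ0.le]
    have a4 : |2 * θ' * s * ρ / μ| ≤ 2 * M * |s| * |ρ| / c := by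
      rw [abs_div, abs_mul, abs_mul, abs_mul, abs_two, abs_of_pos hμ0]
      gcongr
    have a5 : |s| * M * (1 + 1 / m) ≤ |s| * M * (1 + 1 / m) * (1 + Z) :=
      le_mul_of_one_le_right (by positivity) (by linarith)
    have a6 : 2 * M * |s| * |ρ| / c ≤ 2 * M * |s| * |ρ| / c * (1 + Z) :=
      le_mul_of_one_le_right (by positivity) (by linarith)
    have a7 := (abs_add_three (s * θ * (1 - 1 / m)) (μ * (2 * (1 + Z) / m - (2 + q * Z)))
      (2 * θ' * s * ρ / μ)).trans (add_le_add (add_le_add a1 a3) a4)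
    rw [hC₁]
    linarith
  have hE₂le : -C₂ ≤ E₂ := by
    have a1 : 1 / μ ≤ 1 / c := by gcongr
    have a2 : -(M * ρ ^ 2 / c ^ 2) ≤ θ' * ρ ^ 2 / μ ^ 2 := by
      refine neg_le_of_abs_le ?_
      rw [abs_div, abs_mul, abs_of_nonneg (sq_nonneg ρ), abs_of_nonneg (sq_nonneg μ)]
      gcongr
    rw [hC₂, hE₂, neg_div]
    linarith
  have hd2 : d ^ 2 ≤ H * (N / c ^ 2) := by
    rw [← mul_div_assoc, le_div_iff₀ (by positivity)]
    calc d ^ 2 * c ^ 2 ≤ d ^ 2 * μ ^ 2 := by gcongr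
      _ = (μ * d) ^ 2 := by ring
      _ ≤ H * N := hd
  have hyoung : C₁ * (1 + Z) * |d| ≤ c / 2 * (H * (1 + Z) ^ 2) + C₁ ^ 2 / (2 * c ^ 3) * N := by
    have a1 : C₁ * (1 + Z) * |d| ≤ c / 2 * (H * (1 + Z) ^ 2) + C₁ ^ 2 * d ^ 2 / (2 * c * H) := by
      have := sq_nonneg (c * H * (1 + Z) - C₁ * |d|)
      have h2 : c / 2 * (H * (1 + Z) ^ 2) + C₁ ^ 2 * d ^ 2 / (2 * c * H) - C₁ * (1 + Z) * |d|
          = (c * H * (1 + Z) - C₁ * |d|) ^ 2 / (2 * c * H) := by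
        rw [← sq_abs d]
        field_simp
        ring
      have h3 : 0 ≤ (c * H * (1 + Z) - C₁ * |d|) ^ 2 / (2 * c * H) := by positivity
      linarith
    have a2 : C₁ ^ 2 * d ^ 2 / (2 * c * H) ≤ C₁ ^ 2 * (H * (N / c ^ 2)) / (2 * c * H) := by gcongr
    have a3 : C₁ ^ 2 * (H * (N / c ^ 2)) / (2 * c * H) = C₁ ^ 2 / (2 * c ^ 3) * N := by
      field_simp
    linarith
  have hE₁d : -(C₁ * (1 + Z) * |d|) ≤ E₁ * d := by
    refine neg_le_of_abs_le ?_
    rw [abs_mul]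
    gcongr
  have hE₂N : -(C₂ * N) ≤ E₂ * N := by
    rw [← neg_mul]
    gcongr
  have hHmain : H * (c * (1 + Z) ^ 2) ≤ H * bochnerMain m q s Z θ θ' := by gcongr
  have hpos : 0 ≤ μ * d ^ 2 * (1 + 1 / m) / (2 * H) := by positivity
  have hY : c / 2 * H ≤ c / 2 * (H * (1 + Z) ^ 2) := by
    gcongr
    exact le_mul_of_one_le_right hH.le (one_le_pow₀ (by linarith))
  linarith

lemma trace_split_le_sum_sq {ι : Type*} [Fintype ι] [DecidableEq ι] {n : ℝ} (hn : n = Fintype.card ι)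
    (hn1 : 1 < n) {S : ι → ι → ℝ} {y : ι → ℝ} {H α T : ℝ} (hH : 0 < H) (hy : ∑ i, y i ^ 2 = H)
    (hα : ∑ i, ∑ j, S i j * (y i * y j) = α * H) (hT : ∑ i, S i i = T) :
    α ^ 2 + (T - α) ^ 2 / (n - 1) ≤ ∑ i, ∑ j, S i j ^ 2 := by
  set β := (T - α) / (n - 1) with hβ
  set k := (α - β) / H with hk
  have h0 : 0 ≤ ∑ i, ∑ j, (S i j - (k * (y i * y j) + β * if i = j then 1 else 0)) ^ 2 := by
    positivity
  have h1 : ∀ i j, (S i j - (k * (y i * y j) + β * if i = j then 1 else 0)) ^ 2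
      = S i j ^ 2 - 2 * k * (S i j * (y i * y j)) + k ^ 2 * (y i ^ 2 * y j ^ 2)
        + (if i = j then -2 * β * S i j + 2 * k * β * (y i * y j) + β ^ 2 else 0) := by
    intro i j
    split_ifs <;> ring
  simp only [h1, Finset.sum_add_distrib, Finset.sum_sub_distrib, ← Finset.mul_sum, hα,
    Finset.sum_ite_eq, Finset.mem_univ, if_true, hT, ← Finset.sum_mul, hy] at h0
  simp only [← pow_two, hy, Finset.sum_const, Finset.card_univ, nsmul_eq_mul, ← hn] at h0
  have hkH : k * H = α - β := by rw [hk]; field_simp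
  have hβn : β * (n - 1) = T - α := by rw [hβ]; field_simp [(sub_pos.2 hn1).ne']
  have h2 : (T - α) ^ 2 / (n - 1) = β ^ 2 * (n - 1) := by
    rw [hβ]; field_simp [(sub_pos.2 hn1).ne']
  rw [h2]
  have h3 : 2 * k * (α * H) = 2 * (k * H) * α := by ring
  have h4 : k ^ 2 * H ^ 2 = (k * H) ^ 2 := by ring
  have h5 : 2 * k * β * H = 2 * β * (k * H) := by ring
  have h6 : β * T = β * (β * (n - 1) + α) := by rw [hβn]; ring
  simp only [h3, h4, h5, hkH] at h0
  nlinarith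

section
variable {E : Type*} [NormedAddCommGroup E] [InnerProductSpace ℝ E] {ι : Type*} [Fintype ι]

lemma hasStrictFDerivAt_sum_fderiv_sq {h : E → ℝ} (hh : ContDiff ℝ 2 h)
    (b : OrthonormalBasis ι ℝ E) {x y : E} (hy : ∀ v, inner ℝ y v = fderiv ℝ h x v) :
    HasStrictFDerivAt (fun x => ∑ i, fderiv ℝ h x (b i) ^ 2)
      ((2 : ℝ) • fderiv ℝ (fderiv ℝ h) x y) x := by
  have hB : HasStrictFDerivAt (fderiv ℝ h) (fderiv ℝ (fderiv ℝ h) x) x :=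
    (hh.fderiv_right (m := 1) (by norm_num)).contDiffAt.hasStrictFDerivAt one_ne_zero
  have h1 := HasStrictFDerivAt.fun_sum (u := Finset.univ)
    fun i _ => (hB.clm_apply (hasStrictFDerivAt_const (b i) x)).pow 2
  refine h1.congr_fderiv ?_
  ext v
  have hsymm : fderiv ℝ (fderiv ℝ h) x y v = fderiv ℝ (fderiv ℝ h) x v y :=
    (hh.contDiffAt.isSymmSndFDerivAt (by simp)).eq y v
  rw [_root_.smul_apply, hsymm, ← sum_inner_mul_apply b _ y, smul_eq_mul,
    Finset.mul_sum]
  simp only [_root_.sum_apply]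
  refine Finset.sum_congr rfl fun i _ => ?_
  rw [← real_inner_comm, hy]
  simp
  ring

lemma bernstein_first_order {h ζ : E → ℝ} (hh : ContDiff ℝ 2 h) (b : OrthonormalBasis ι ℝ E)
    {x₁ y : E} (hy : ∀ v, inner ℝ y v = fderiv ℝ h x₁ v) (hy0 : y ≠ 0) {ω θ : ℝ → ℝ}
    (hω : ∀ t, HasDerivAt ω (θ t) t) {ρ s : ℝ} (hζ : ContDiffAt ℝ 2 ζ x₁)
    (hmax : IsLocalMax (fun x => Real.log (∑ i, fderiv ℝ h x (b i) ^ 2)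
      + ω (ρ * Real.log (∑ i, fderiv ℝ h x (b i) ^ 2) + s * h x) + ζ x) x₁)
    {t : ℝ} (ht : t = ρ * Real.log (‖y‖ ^ 2) + s * h x₁) (v : E) :
    (1 + ρ * θ t) * (2 * fderiv ℝ (fderiv ℝ h) x₁ y v / ‖y‖ ^ 2)
      + s * θ t * fderiv ℝ h x₁ v + fderiv ℝ ζ x₁ v = 0 := by
  have hH1 : ∑ i, fderiv ℝ h x₁ (b i) ^ 2 = ‖y‖ ^ 2 := sum_apply_sq_eq b hy
  have hypos : 0 < ‖y‖ ^ 2 := by positivity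
  have hH := (hasStrictFDerivAt_sum_fderiv_sq hh b hy).hasFDerivAt
  have hlog := hH.log (by rw [hH1]; exact hypos.ne')
  have hdh := (hh.differentiable (by norm_num) x₁).hasFDerivAt
  have hdζ := (hζ.differentiableAt (by norm_num)).hasFDerivAt
  have harg := (hlog.const_mul ρ).add (hdh.const_mul s)
  have ht' : ρ * Real.log (∑ i, fderiv ℝ h x₁ (b i) ^ 2) + s * h x₁ = t := by rw [hH1, ht]
  have hωt := hω t
  rw [← ht'] at hωt
  have hzero := hmax.hasFDerivAt_eq_zero
    ((hlog.add (hωt.comp_hasFDerivAt x₁ harg)).add hdζ)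
  have := DFunLike.congr_fun hzero v
  simp only [hH1, _root_.add_apply, _root_.smul_apply, smul_eq_mul, _root_.zero_apply] at this
  rw [← this, ← ht]
  field_simp
  ring

lemma exists_bernstein_bound [FiniteDimensional ℝ E] [DecidableEq ι] {n q s : ℝ}
    (hn : n = Fintype.card ι) (hn1 : 1 < n) (hq : 0 ≤ q) (Φ : BernsteinProfile (n - 1) q s)
    (b : OrthonormalBasis ι ℝ E) :
    ∃ C, 0 ≤ C ∧ ∀ {h ζ : E → ℝ} {x₁ : E}, ContDiff ℝ 2 h → ContDiffAt ℝ 2 ζ x₁ →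
      (∀ x, ∑ i, fderiv ℝ (fderiv ℝ h) x (b i) (b i) = -∑ i, fderiv ℝ h x (b i) ^ 2
        - (∑ i, fderiv ℝ h x (b i) ^ 2) ^ (q / 2) * Real.exp (s * h x)) →
      0 < ∑ i, fderiv ℝ h x₁ (b i) ^ 2 →
      IsLocalMax (fun x => Real.log (∑ i, fderiv ℝ h x (b i) ^ 2)
        + Φ.ω ((q / 2 - 1) * Real.log (∑ i, fderiv ℝ h x (b i) ^ 2) + s * h x) + ζ x) x₁ →
      Φ.c / 2 * ∑ i, fderiv ℝ h x₁ (b i) ^ 2 ≤ C * ∑ i, fderiv ℝ ζ x₁ (b i) ^ 2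
        - ∑ i, fderiv ℝ (fderiv ℝ ζ) x₁ (b i) (b i) := by
  have : CompleteSpace E := FiniteDimensional.complete ℝ E
  obtain ⟨C, hC, halg⟩ := bernstein_algebra (sub_pos.2 hn1) hq Φ
  refine ⟨C, hC, fun {h ζ x₁} hh hζ hg hHpos hmax => ?_⟩
  set y : E := (InnerProductSpace.toDual ℝ E).symm (fderiv ℝ h x₁)
  have hy : ∀ v, inner ℝ y v = fderiv ℝ h x₁ v := fun v =>
    InnerProductSpace.toDual_symm_apply
  have hH1 : ∑ i, fderiv ℝ h x₁ (b i) ^ 2 = ‖y‖ ^ 2 := sum_apply_sq_eq b hy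
  have hy0 : y ≠ 0 := by
    rintro h0
    simp [hH1, h0] at hHpos
  have hμ : ∀ t, 0 < 1 + (q / 2 - 1) * Φ.θ t := fun t => Φ.c_pos.trans_le (Φ.le_slope t)
  set t := (q / 2 - 1) * Real.log (‖y‖ ^ 2) + s * h x₁ with ht
  set μ := 1 + (q / 2 - 1) * Φ.θ t with hμdef
  have hμ0 : 0 < μ := hμ t
  set H := ‖y‖ ^ 2 with hHdef
  have hH0 : 0 < H := by positivity
  set B := fderiv ℝ (fderiv ℝ h) x₁ with hB
  set l : ι → ℝ := fun i => 2 * B y (b i) / H with hl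
  have hsum := hasStrictFDerivAt_sum_fderiv_sq hh b hy
  have hdh : HasStrictFDerivAt h (fderiv ℝ h x₁) x₁ :=
    hh.contDiffAt.hasStrictFDerivAt (by norm_num)
  have hDy : fderiv ℝ h x₁ y = H := by rw [← hy, real_inner_self_eq_norm_sq]
  obtain ⟨g', hg', hg'y⟩ : ∃ g' : E →L[ℝ] ℝ, HasStrictFDerivAt
      (fun x => -∑ i, fderiv ℝ h x (b i) ^ 2
        - (∑ i, fderiv ℝ h x (b i) ^ 2) ^ (q / 2) * Real.exp (s * h x)) g' x₁ ∧
      g' y = -(2 * B y y) - (H ^ (q / 2) * (Real.exp (s * h x₁) * (s * H))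
        + Real.exp (s * h x₁) * (q / 2 * H ^ (q / 2 - 1) * (2 * B y y))) :=
    ⟨_, hsum.neg.sub ((hsum.rpow_const (p := q / 2) (Or.inl hHpos.ne')).mul
      (hdh.const_mul s).exp), by simp [hDy, hH1, hB]⟩
  have hsec := bochner_second_order hh b hg hg' hy hy0 Φ.hasDerivAt_ω Φ.hasDerivAt_θ
    Φ.continuous_θ' hμ hζ hmax ht (l := l) fun i => rfl
  have hfirst := fun i => bernstein_first_order hh b hy hy0 Φ.hasDerivAt_ω hζ hmax ht (b i)
  have hG : H ^ (q / 2) * Real.exp (s * h x₁) = H * Real.exp t := by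
    rw [ht, Real.exp_add, ← mul_assoc, Real.rpow_def_of_pos hH0]
    congr 1
    nth_rw 2 [← Real.exp_log hH0]
    rw [← Real.exp_add]
    congr 1
    ring
  have hG' : H ^ (q / 2 - 1) * Real.exp (s * h x₁) = Real.exp t := by
    rw [ht, Real.exp_add, Real.rpow_def_of_pos hH0, mul_comm (Real.log _)]
  set Z := Real.exp t with hZ
  set z : ι → ℝ := fun i => fderiv ℝ h x₁ (b i) with hz
  set w : ι → ℝ := fun i => -fderiv ℝ ζ x₁ (b i) with hw
  have hBv : ∀ v, ∑ i, z i * B v (b i) = B v y := fun v => by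
    rw [← sum_inner_mul_apply b (B v) y]
    exact Finset.sum_congr rfl fun i _ => by rw [real_inner_comm, hy]
  have hlz : ∀ i, l i = -(s * Φ.θ t / μ) * z i + w i / μ := fun i => by
    have h1 : μ * l i + s * Φ.θ t * z i + fderiv ℝ ζ x₁ (b i) = 0 := hfirst i
    have h2 : w i = -fderiv ℝ ζ x₁ (b i) := rfl
    field_simp
    linarith
  set P := ∑ i, l i * z i with hP
  set d := (∑ i, w i * z i) / μ with hd
  have hByy : 2 * B y y = H * P := by
    rw [← hBv y, hP, Finset.mul_sum, Finset.mul_sum]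
    refine Finset.sum_congr rfl fun i _ => ?_
    simp only [hl]
    field_simp
  have hzz : ∑ i, z i ^ 2 = H := hH1
  have hN : ∑ i, fderiv ℝ ζ x₁ (b i) ^ 2 = ∑ i, w i ^ 2 := by simp [hw]
  set N := ∑ i, w i ^ 2 with hNdef
  have hwz : ∑ i, w i * z i = μ * d := by rw [hd]; field_simp
  have hquad : ∀ a c : ℝ, ∑ i, (a * z i + c * w i) ^ 2
      = a ^ 2 * H + 2 * a * c * (μ * d) + c ^ 2 * N := fun a c => by
    rw [← hzz, ← hwz, hNdef, Finset.mul_sum, Finset.mul_sum, Finset.mul_sum,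
      ← Finset.sum_add_distrib, ← Finset.sum_add_distrib]
    exact Finset.sum_congr rfl fun i _ => by ring
  rw [hN, hH1]
  refine halg t H P d N (∑ i, l i ^ 2) (∑ i, ∑ j, B (b i) (b j) ^ 2)
    (∑ i, ((q / 2 - 1) * l i + s * z i) ^ 2) (∑ i, fderiv ℝ (fderiv ℝ ζ) x₁ (b i) (b i)) Z μ
    hH0 (Finset.sum_nonneg fun i _ => sq_nonneg _) rfl rfl ?_ ?_ ?_ ?_ ?_ ?_
  · rw [hP, hd, ← hzz, Finset.mul_sum, Finset.sum_div, ← Finset.sum_add_distrib]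
    exact Finset.sum_congr rfl fun i _ => by rw [hlz]; ring
  · rw [← hwz, ← hzz, mul_comm]
    exact Finset.sum_mul_sq_le_sq_mul_sq _ _ _
  · have := hquad (-(s * Φ.θ t / μ)) (1 / μ)
    simp only [hlz]
    simp only [div_mul_eq_mul_div, one_mul] at this ⊢
    rw [this]
    field_simp
    ring
  · have e : ∀ i, (q / 2 - 1) * l i + s * z i = s / μ * z i + (q / 2 - 1) / μ * w i := fun i => by
      rw [hlz]
      field_simp
      rw [hμdef]
      ring
    simp only [e]
    rw [hquad]
    field_simp
  · have htr := trace_split_le_sum_sq hn hn1 (S := fun i j => B (b i) (b j)) (y := z)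
      (α := P / 2) (T := -(H * (1 + Z))) hH0 hzz ?_ ?_
    · refine le_trans (le_of_eq ?_) htr
      ring
    · have e : ∀ i, ∑ j, B (b i) (b j) * (z i * z j) = z i * B y (b i) := fun i => by
        rw [show B y (b i) = B (b i) y from
          (hh.contDiffAt.isSymmSndFDerivAt (by simp)).eq y (b i), ← hBv, Finset.mul_sum]
        exact Finset.sum_congr rfl fun j _ => by ring
      simp only [e]
      rw [hBv]
      linarith
    · rw [hg, hH1, hG]; ring
  · refine le_trans (le_of_eq ?_) hsec
    have hgy : g' y = -(1 + q / 2 * Z) * H * P - s * Z * H ^ 2 := by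
      rw [hg'y]
      linear_combination (-1 - Real.exp (s * h x₁) * (q / 2) * H ^ (q / 2 - 1)) * hByy
        - s * H * hG - q / 2 * H * P * hG'
    rw [hH1, hG, hgy]
    ring

end

section
variable {E : Type*} [NormedAddCommGroup E] [InnerProductSpace ℝ E] {ι : Type*} [Fintype ι]

lemma log_cutoff_estimates (b : OrthonormalBasis ι ℝ E) {x₀ x₁ : E} {R η : ℝ} (hR : 0 < R)
    (hx : ‖x₁ - x₀‖ < R) (hη : η = 1 - ‖x₁ - x₀‖ ^ 2 / R ^ 2) {ζ : E → ℝ}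
    (hζ : ζ = fun x => 2 * Real.log (1 - ‖x - x₀‖ ^ 2 / R ^ 2)) :
    ContDiffAt ℝ 2 ζ x₁ ∧ ∑ i, fderiv ℝ ζ x₁ (b i) ^ 2 ≤ 16 / (R ^ 2 * η ^ 2) ∧
      -∑ i, fderiv ℝ (fderiv ℝ ζ) x₁ (b i) (b i)
        ≤ (4 * Fintype.card ι + 8) / (R ^ 2 * η ^ 2) := by
  have hr : ‖x₁ - x₀‖ ^ 2 ≤ R ^ 2 := by gcongr
  have hη0 : 0 < η := by
    rw [hη, sub_pos, div_lt_one (by positivity)]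
    gcongr
  have hη1 : η ≤ 1 := by
    rw [hη]
    linarith [show 0 ≤ ‖x₁ - x₀‖ ^ 2 / R ^ 2 by positivity]
  have hcd : ContDiff ℝ 2 fun x : E => 1 - ‖x - x₀‖ ^ 2 / R ^ 2 :=
    contDiff_const.sub (((contDiff_id.sub contDiff_const).norm_sq ℝ).div_const _)
  have hpos : ∀ᶠ x in 𝓝 x₁, 0 < 1 - ‖x - x₀‖ ^ 2 / R ^ 2 :=
    hcd.continuous.continuousAt.eventually_const_lt (by simpa only [← hη] using hη0)
  have hdη : ∀ x : E, HasFDerivAt (fun x => 1 - ‖x - x₀‖ ^ 2 / R ^ 2)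
      ((-2 / R ^ 2) • innerSL ℝ (x - x₀)) x := fun x => by
    have h1 := (((hasFDerivAt_id x).sub_const x₀).norm_sq.mul_const (R ^ 2)⁻¹).const_sub 1
    simp only [← div_eq_mul_inv] at h1
    refine h1.congr_fderiv ?_
    ext v
    simp
    ring
  have hdζ : ∀ᶠ x in 𝓝 x₁, fderiv ℝ ζ x
      = ((-4 / R ^ 2) * (1 - ‖x - x₀‖ ^ 2 / R ^ 2)⁻¹) • innerSL ℝ (x - x₀) := by
    filter_upwards [hpos] with x hx
    rw [hζ, (((hdη x).log hx.ne').const_mul 2).fderiv]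
    ext v
    simp
    ring
  have hinner : HasFDerivAt (fun x : E => innerSL ℝ (x - x₀)) (innerSL ℝ : E →L[ℝ] E →L[ℝ] ℝ) x₁ := by
    exact ((innerSL ℝ : E →L[ℝ] E →L[ℝ] ℝ).hasFDerivAt).comp x₁
      ((hasFDerivAt_id x₁).sub_const x₀)
  have hinv := (hasDerivAt_inv hη0.ne').comp_hasFDerivAt_of_eq x₁ (hdη x₁) hη
  have hd2 := ((hinv.const_mul (-4 / R ^ 2)).smul hinner).congr_of_eventuallyEq hdζ
  have h1 : ∀ v, fderiv ℝ ζ x₁ v = -4 / (R ^ 2 * η) * inner ℝ v (x₁ - x₀) := fun v => by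
    rw [hdζ.self_of_nhds, ← hη]
    simp only [_root_.smul_apply, smul_eq_mul, innerSL_apply_apply, real_inner_comm v]
    field_simp
  have h2 : ∀ i, fderiv ℝ (fderiv ℝ ζ) x₁ (b i) (b i)
      = -4 / (R ^ 2 * η) - 8 / (R ^ 4 * η ^ 2) * inner ℝ (b i) (x₁ - x₀) ^ 2 := fun i => by
    have hbb : (innerSL ℝ : E →L[ℝ] E →L[ℝ] ℝ) (b i) (b i) = 1 :=
      (innerSL_apply_apply ℝ _ _).trans (by simp)
    rw [hd2.fderiv]
    simp only [hbb, Function.comp_apply, ← hη, _root_.add_apply, _root_.smul_apply, smul_eq_mul,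
      ContinuousLinearMap.smulRight_apply, innerSL_apply_apply, real_inner_comm (b i) (x₁ - x₀)]
    field_simp
    ring
  refine ⟨hζ ▸ contDiffAt_const.mul (hcd.contDiffAt.log (hη ▸ hη0.ne')), ?_, ?_⟩
  · simp only [h1, mul_pow, ← Finset.mul_sum, sum_inner_sq]
    calc (-4 / (R ^ 2 * η)) ^ 2 * ‖x₁ - x₀‖ ^ 2 ≤ (-4 / (R ^ 2 * η)) ^ 2 * R ^ 2 := by gcongr
      _ = 16 / (R ^ 2 * η ^ 2) := by field_simp; norm_num
  · simp only [h2, Finset.sum_sub_distrib, ← Finset.mul_sum, sum_inner_sq, Finset.sum_const,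
      Finset.card_univ, nsmul_eq_mul]
    have a1 : 8 / (R ^ 4 * η ^ 2) * ‖x₁ - x₀‖ ^ 2 ≤ 8 / (R ^ 4 * η ^ 2) * R ^ 2 := by gcongr
    have a2 : 8 / (R ^ 4 * η ^ 2) * R ^ 2 = 8 / (R ^ 2 * η ^ 2) := by field_simp
    have a3 : 4 / (R ^ 2 * η) ≤ 4 / (R ^ 2 * η ^ 2) := by
      gcongr
      nlinarith
    have a4 := mul_le_mul_of_nonneg_left a3 (Nat.cast_nonneg (α := ℝ) (Fintype.card ι))
    have a5 : (4 * (Fintype.card ι : ℝ) + 8) / (R ^ 2 * η ^ 2)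
        = Fintype.card ι * (4 / (R ^ 2 * η ^ 2)) + 8 / (R ^ 2 * η ^ 2) := by ring
    rw [a5, neg_div]
    linarith

lemma continuous_mul_exp_comp_log {X : Type*} [TopologicalSpace X] {H k : X → ℝ} {ω : ℝ → ℝ}
    {M ρ : ℝ} (hH : Continuous H) (hH0 : ∀ x, 0 ≤ H x) (hk : Continuous k) (hω : Continuous ω)
    (hM : ∀ t, ω t ≤ M) :
    Continuous fun x => H x * Real.exp (ω (ρ * Real.log (H x) + k x)) := by
  refine continuous_iff_continuousAt.2 fun x => ?_
  rcases (hH0 x).eq_or_lt' with h0 | h0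
  · have h1 : Tendsto (fun x => H x * Real.exp M) (𝓝 x) (𝓝 0) := by
      simpa [h0] using (hH.mul_const (Real.exp M)).tendsto x
    rw [ContinuousAt, h0, zero_mul]
    refine squeeze_zero (fun y => mul_nonneg (hH0 y) (Real.exp_pos _).le) (fun y => ?_) h1
    exact mul_le_mul_of_nonneg_left (Real.exp_le_exp.2 (hM _)) (hH0 y)
  · have := (Real.continuousAt_log h0.ne').comp hH.continuousAt
    exact hH.continuousAt.mul (Real.continuous_exp.continuousAt.comp
      (hω.continuousAt.comp ((this.const_mul ρ).add hk.continuousAt)))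

lemma fderiv_eq_zero_of_log_equation [FiniteDimensional ℝ E] [DecidableEq ι] {n q s : ℝ}
    (hn : n = Fintype.card ι) (hn1 : 1 < n) (hq : 0 ≤ q) (Φ : BernsteinProfile (n - 1) q s)
    (b : OrthonormalBasis ι ℝ E) {h : E → ℝ} (hh : ContDiff ℝ 2 h)
    (hg : ∀ x, ∑ i, fderiv ℝ (fderiv ℝ h) x (b i) (b i) = -∑ i, fderiv ℝ h x (b i) ^ 2
        - (∑ i, fderiv ℝ h x (b i) ^ 2) ^ (q / 2) * Real.exp (s * h x)) (x₀ : E) :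
    ∑ i, fderiv ℝ h x₀ (b i) ^ 2 = 0 := by
  have : ProperSpace E := FiniteDimensional.proper ℝ E
  obtain ⟨C, hC, hbound⟩ := exists_bernstein_bound hn hn1 hq Φ b
  have hωc : Continuous Φ.ω := continuous_iff_continuousAt.2 fun t =>
    (Φ.hasDerivAt_ω t).continuousAt
  have hc := Φ.c_pos
  have hdh : Continuous (fderiv ℝ h) := hh.continuous_fderiv (by norm_num)
  set H : E → ℝ := fun x => ∑ i, fderiv ℝ h x (b i) ^ 2 with hHdef
  have hHc : Continuous H := by fun_prop
  have hH0 : ∀ x, 0 ≤ H x := fun x => Finset.sum_nonneg fun i _ => sq_nonneg _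
  have hFc := continuous_mul_exp_comp_log (ρ := q / 2 - 1) hHc hH0
    (hh.continuous.const_mul s) hωc Φ.ω_le
  set w : E → ℝ := fun x => Φ.ω ((q / 2 - 1) * Real.log (H x) + s * h x) with hw
  set F : E → ℝ := fun x => H x * Real.exp (w x) with hF
  by_contra hne
  have hF0 : 0 < F x₀ := mul_pos ((hH0 x₀).lt_of_ne' hne) (Real.exp_pos _)
  set K := Real.exp Φ.M * (2 / Φ.c * (C * 16 + (4 * n + 8))) with hK
  have hKpos : 0 < K := by positivity
  set R := √(2 * K / F x₀) with hRdef
  have hR : 0 < R := by positivity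
  have hR2 : R ^ 2 = 2 * K / F x₀ := Real.sq_sqrt (by positivity)
  set η : E → ℝ := fun x => 1 - ‖x - x₀‖ ^ 2 / R ^ 2 with hη
  have hηc : Continuous η := by fun_prop
  obtain ⟨x₁, hx₁, hmax⟩ := (isCompact_closedBall x₀ R).exists_isMaxOn
    ⟨x₀, Metric.mem_closedBall_self hR.le⟩ (hFc.mul (hηc.pow 2)).continuousOn
  have hx₀₁ : F x₀ ≤ F x₁ * η x₁ ^ 2 := by
    have := hmax (Metric.mem_closedBall_self hR.le)
    simpa [hη] using this
  have hη1 : η x₁ ≠ 0 := by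
    intro h0
    rw [h0] at hx₀₁
    linarith [zero_pow (M₀ := ℝ) two_ne_zero]
  have hHx₁ : 0 < H x₁ := (hH0 x₁).lt_of_ne' fun h0 => by
    simp only [hF, h0] at hx₀₁ hF0
    linarith
  have hx₁R : ‖x₁ - x₀‖ < R := by
    refine (mem_closedBall_iff_norm.1 hx₁).lt_of_ne fun h0 => hη1 ?_
    simp [hη, h0, hR.ne']
  have hη1pos : 0 < η x₁ := by
    simp only [hη]
    rw [sub_pos, div_lt_one (by positivity)]
    gcongr
  obtain ⟨hζ, hN, hL⟩ := log_cutoff_estimates b hR hx₁R rfl (ζ := fun x => 2 * Real.log (η x)) rfl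
  have hloc : IsLocalMax (fun x => Real.log (H x) + w x + 2 * Real.log (η x)) x₁ := by
    filter_upwards [hHc.continuousAt.eventually_const_lt hHx₁,
      hηc.continuousAt.eventually_const_lt hη1pos,
      Metric.closedBall_mem_nhds_of_mem (mem_ball_iff_norm.2 hx₁R)] with x hHx hηx hx
    have hlog : ∀ x, 0 < H x → 0 < η x →
        Real.log (H x) + w x + 2 * Real.log (η x) = Real.log (F x * η x ^ 2) := by
      intro x h1 h2
      rw [Real.log_mul (by positivity) (by positivity), Real.log_mul h1.ne' (by positivity),
        Real.log_exp, Real.log_pow]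
      norm_num
    rw [hlog x hHx hηx, hlog x₁ hHx₁ hη1pos]
    exact Real.log_le_log (by positivity) (hmax hx)
  have hb := hbound hh hζ hg hHx₁ hloc
  have hb' : Φ.c / 2 * H x₁ ≤ (C * 16 + (4 * n + 8)) / (R ^ 2 * η x₁ ^ 2) := by
    refine hb.trans ?_
    rw [add_div, mul_div_assoc, hn]
    have := mul_le_mul_of_nonneg_left hN hC
    simp only [hη] at this hL ⊢
    linarith
  have hHη : H x₁ * η x₁ ^ 2 ≤ 2 / Φ.c * (C * 16 + (4 * n + 8)) / R ^ 2 := by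
    have := mul_le_mul_of_nonneg_left hb' (show 0 ≤ 2 / Φ.c * η x₁ ^ 2 by positivity)
    refine le_trans (le_of_eq ?_) (this.trans (le_of_eq ?_)) <;> field_simp
  have hFK : F x₁ * η x₁ ^ 2 ≤ K / R ^ 2 := by
    calc F x₁ * η x₁ ^ 2 = Real.exp (w x₁) * (H x₁ * η x₁ ^ 2) := by simp only [hF]; ring
      _ ≤ Real.exp Φ.M * (2 / Φ.c * (C * 16 + (4 * n + 8)) / R ^ 2) := by
        gcongr
        exact Φ.ω_le _
      _ = K / R ^ 2 := by rw [hK]; ring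
  have : K / R ^ 2 = F x₀ / 2 := by rw [hR2]; field_simp
  linarith

end

lemma fderiv_log_apply {E : Type*} [NormedAddCommGroup E] [NormedSpace ℝ E] {u : E → ℝ}
    (hu : ContDiff ℝ 2 u) (hpos : ∀ x, 0 < u x) (x v : E) :
    fderiv ℝ (fun x => Real.log (u x)) x v = fderiv ℝ u x v / u x := by
  rw [((hu.differentiable (by norm_num) x).hasFDerivAt.log (hpos x).ne').fderiv]
  simp [div_eq_inv_mul]

lemma fderiv_fderiv_log_apply {E : Type*} [NormedAddCommGroup E] [NormedSpace ℝ E] {u : E → ℝ}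
    (hu : ContDiff ℝ 2 u) (hpos : ∀ x, 0 < u x) (x v : E) :
    fderiv ℝ (fderiv ℝ fun x => Real.log (u x)) x v v
      = fderiv ℝ (fun y => fderiv ℝ u y v) x v / u x - (fderiv ℝ u x v / u x) ^ 2 := by
  have hlog : ContDiff ℝ 2 fun x => Real.log (u x) := hu.log fun x => (hpos x).ne'
  have h1 : DifferentiableAt ℝ (fderiv ℝ fun x => Real.log (u x)) x :=
    (hlog.fderiv_right (m := 1) (by norm_num)).differentiable (by norm_num) x
  have h2 : DifferentiableAt ℝ (fderiv ℝ u) x :=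
    (hu.fderiv_right (m := 1) (by norm_num)).differentiable (by norm_num) x
  have h3 : DifferentiableAt ℝ (fun y => fderiv ℝ u y v) x :=
    h2.clm_apply (differentiableAt_const v)
  have h4 : fderiv ℝ (fun y => fderiv ℝ (fun x => Real.log (u x)) y v) x v
      = fderiv ℝ (fderiv ℝ fun x => Real.log (u x)) x v v := by
    rw [fderiv_clm_apply h1 (differentiableAt_const v)]
    simp
  rw [← h4]
  simp only [fderiv_log_apply hu hpos]
  have h5 := (hu.differentiable (by norm_num) x).hasFDerivAt
  have h6 := h3.hasFDerivAt.mul ((hasDerivAt_inv (hpos x).ne').comp_hasFDerivAt x h5)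
  rw [show (fun y => fderiv ℝ u y v / u y) = (fun y => fderiv ℝ u y v) * (fun y => y⁻¹) ∘ u from
    funext fun y => div_eq_mul_inv _ _, h6.fderiv]
  have := (hpos x).ne'
  simp only [Function.comp_apply, _root_.add_apply, _root_.smul_apply, smul_eq_mul]
  field_simp
  ring

lemma log_equation {n : ℕ} {p q : ℝ} {u : EuclideanSpace ℝ (Fin n) → ℝ}
    (hu : ContDiff ℝ 2 u) (hpos : ∀ x, 0 < u x)
    (heq : ∀ x, elaplacian u x + ‖gradient u x‖ ^ q * u x ^ p = 0)
    (x : EuclideanSpace ℝ (Fin n)) :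
    ∑ i, fderiv ℝ (fderiv ℝ fun x => Real.log (u x)) x (EuclideanSpace.basisFun (Fin n) ℝ i)
        (EuclideanSpace.basisFun (Fin n) ℝ i)
      = -∑ i, fderiv ℝ (fun x => Real.log (u x)) x (EuclideanSpace.basisFun (Fin n) ℝ i) ^ 2
        - (∑ i, fderiv ℝ (fun x => Real.log (u x)) x
            (EuclideanSpace.basisFun (Fin n) ℝ i) ^ 2) ^ (q / 2)
          * Real.exp ((p + q - 1) * Real.log (u x)) := by
  have hx := hpos x
  have hgrad : ∀ v, inner ℝ (gradient u x) v = fderiv ℝ u x v := fun v =>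
    InnerProductSpace.toDual_symm_apply
  have hsum : ∑ i, fderiv ℝ u x (EuclideanSpace.basisFun (Fin n) ℝ i) ^ 2 = ‖gradient u x‖ ^ 2 :=
    sum_apply_sq_eq _ hgrad
  simp only [fderiv_fderiv_log_apply hu hpos, fderiv_log_apply hu hpos, Finset.sum_sub_distrib,
    ← Finset.sum_div, div_pow, hsum]
  have hlap : ∑ i, fderiv ℝ (fun y => fderiv ℝ u y (EuclideanSpace.basisFun (Fin n) ℝ i)) x
      (EuclideanSpace.basisFun (Fin n) ℝ i) = -(‖gradient u x‖ ^ q * u x ^ p) := by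
    have := heq x
    rw [elaplacian] at this
    simp only [EuclideanSpace.basisFun_apply]
    linarith
  have hpow : (‖gradient u x‖ ^ 2 / u x ^ 2) ^ (q / 2) = ‖gradient u x‖ ^ q / u x ^ q := by
    rw [← div_pow, ← Real.rpow_natCast, ← Real.rpow_mul (by positivity),
      ← Real.div_rpow (norm_nonneg _) hx.le]
    congr 1
    push_cast
    ring
  have hexp : Real.exp ((p + q - 1) * Real.log (u x)) = u x ^ p * u x ^ q / u x := by
    rw [mul_comm, ← Real.rpow_def_of_pos hx, Real.rpow_sub_one hx.ne', Real.rpow_add hx]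
  rw [hlap, hpow, hexp]
  have := (Real.rpow_pos_of_pos hx q).ne'
  field_simp
  ring

end

/-- **Theorem 1.1, case (4).** For `n ≥ 3`, `q > 0` and `p + q ≤ (n+2)/(n−2)`, every
positive classical solution of `Δu + |∇u|^q u^p = 0` on all of `ℝⁿ` is constant. -/
theorem liouville_linear_constraint (n : ℕ) (hn : 3 ≤ n) (p q : ℝ)
    (hq : 0 < q) (hpq : p + q ≤ ((n : ℝ) + 2) / ((n : ℝ) - 2))
    (u : EuclideanSpace ℝ (Fin n) → ℝ)
    (hu : ContDiff ℝ 2 u)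
    (hpos : ∀ x, 0 < u x)
    (heq : ∀ x, elaplacian u x + ‖gradient u x‖ ^ q * u x ^ p = 0) :
    ∀ x y, u x = u y := by
  have hn' : (3 : ℝ) ≤ n := by exact_mod_cast hn
  have hs : p + q - 1 ≤ 4 / ((n : ℝ) - 1 - 1) := by
    have h2 : (0 : ℝ) < n - 2 := by linarith
    have h4 : 4 / ((n : ℝ) - 1 - 1) = ((n : ℝ) + 2) / ((n : ℝ) - 2) - 1 := by
      rw [show (n : ℝ) - 1 - 1 = n - 2 by ring]
      field_simp
      ring
    linarith
  obtain ⟨Φ⟩ := nonempty_profile (m := (n : ℝ) - 1) (by linarith) hq hs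
  have hzero := fderiv_eq_zero_of_log_equation (by simp) (by linarith) hq.le Φ
    (EuclideanSpace.basisFun (Fin n) ℝ) (hu.log fun x => (hpos x).ne') (log_equation hu hpos heq)
  refine is_const_of_fderiv_eq_zero (hu.differentiable (by norm_num)) fun x => ?_
  have h1 := (Finset.sum_eq_zero_iff_of_nonneg fun i _ => sq_nonneg _).1 (hzero x)
  ext v
  rw [← sum_inner_mul_apply (EuclideanSpace.basisFun (Fin n) ℝ)]
  refine Finset.sum_eq_zero fun i hi => ?_
  have h2 := pow_eq_zero_iff two_ne_zero |>.1 (h1 i hi)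
  rw [fderiv_log_apply hu hpos, div_eq_zero_iff, or_iff_left (hpos x).ne'] at h2
  rw [h2, mul_zero]
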